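/- Let n ≥ 1, l ∈ ℕ, 0 < α < n, 1 < q ≤ p < ∞, and let s, t satisfy 1/s = 1/p − α/n > 0 and p/q = s/t. There is a constant C, independent of a_1, …, a_l, such that for all a_1, …, a_l ∈ BMO(ℝ^n) and all f ∈ M^p_q(ℝ^n), ‖[a_{{1,…,l}}, I_α]f‖_{M^s_t} ≤ C (∏_{j=1}^l ‖a_j‖_*) ‖f‖_{M^p_q}; that is, the operator norm of [a_{{1,…,l}}, I_α] from M^p_q(ℝ^n) to M^s_t(ℝ^n) is at most C ∏_{j=1}^l ‖a_j‖_*. -/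

import Mathlib

open MeasureTheory Metric ENNReal

noncomputable section

/-- Euclidean space ℝⁿ. -/
abbrev Eucl (n : ℕ) := EuclideanSpace ℝ (Fin n)

/-- The Morrey norm ‖f‖_{M^p_q}. -/
noncomputable def morreyNorm (n : ℕ) (p q : ℝ) (f : Eucl n → ℝ) : ℝ≥0∞ :=
  ⨆ (x : Eucl n) (r : ℝ) (_ : 0 < r),
    (volume (ball x r)) ^ (1 / p - 1 / q) *
      (∫⁻ y in ball x r, ENNReal.ofReal (|f y| ^ q)) ^ (1 / q)

/-- Membership in the Morrey space M^p_q(ℝⁿ). -/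
def MemMorrey (n : ℕ) (p q : ℝ) (f : Eucl n → ℝ) : Prop :=
  Measurable f ∧ morreyNorm n p q f < ⊤

/-- Average of `b` over the ball `B(x,r)`. -/
noncomputable def ballAvg (n : ℕ) (b : Eucl n → ℝ) (x : Eucl n) (r : ℝ) : ℝ :=
  ⨍ y in ball x r, b y

/-- The BMO norm ‖b‖_*. -/
noncomputable def bmoNorm (n : ℕ) (b : Eucl n → ℝ) : ℝ≥0∞ :=
  ⨆ (x : Eucl n) (r : ℝ) (_ : 0 < r),
    (volume (ball x r))⁻¹ *
      ∫⁻ y in ball x r, ENNReal.ofReal |b y - ballAvg n b x r|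

/-- Membership in BMO(ℝⁿ). -/
def MemBMO (n : ℕ) (b : Eucl n → ℝ) : Prop :=
  LocallyIntegrable b volume ∧ bmoNorm n b < ⊤

/-- Smooth compactly supported functions (the class C_c^∞). -/
def IsCcSmooth (n : ℕ) (φ : Eucl n → ℝ) : Prop :=
  ContDiff ℝ (⊤ : ℕ∞) φ ∧ HasCompactSupport φ

/-- VMO(ℝⁿ): the closure of C_c^∞ in the BMO norm. -/
def MemVMO (n : ℕ) (b : Eucl n → ℝ) : Prop :=
  MemBMO n b ∧ ∀ ε : ℝ, 0 < ε → ∃ φ : Eucl n → ℝ, IsCcSmooth n φ ∧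
    bmoNorm n (fun x => b x - φ x) < ENNReal.ofReal ε

/-- The tilde subspace: closure of C_c^∞ in the Morrey norm. -/
def MemTildeMorrey (n : ℕ) (p q : ℝ) (f : Eucl n → ℝ) : Prop :=
  MemMorrey n p q f ∧ ∀ ε : ℝ, 0 < ε → ∃ φ : Eucl n → ℝ, IsCcSmooth n φ ∧
    morreyNorm n p q (fun x => f x - φ x) < ENNReal.ofReal ε

/-- The bar subspace: closure of L^∞ ∩ M^p_q in the Morrey norm. -/
def MemBarMorrey (n : ℕ) (p q : ℝ) (f : Eucl n → ℝ) : Prop :=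
  MemMorrey n p q f ∧ ∀ ε : ℝ, 0 < ε → ∃ g : Eucl n → ℝ, MemMorrey n p q g ∧
    (∃ C : ℝ, ∀ᵐ x ∂(volume : Measure (Eucl n)), |g x| ≤ C) ∧
    morreyNorm n p q (fun x => f x - g x) < ENNReal.ofReal ε

/-- The star subspace: closure of the compactly supported members of M^p_q. -/
def MemStarMorrey (n : ℕ) (p q : ℝ) (f : Eucl n → ℝ) : Prop :=
  MemMorrey n p q f ∧ ∀ ε : ℝ, 0 < ε → ∃ g : Eucl n → ℝ, MemMorrey n p q g ∧
    HasCompactSupport g ∧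
    morreyNorm n p q (fun x => f x - g x) < ENNReal.ofReal ε

/-- The fractional integral operator I_α. -/
noncomputable def fracInt (n : ℕ) (α : ℝ) (f : Eucl n → ℝ) (x : Eucl n) : ℝ :=
  ∫ y, f y * dist x y ^ (α - (n : ℝ))

/-- The multilinear commutator [a_{{1,…,l}}, I_α]. -/
noncomputable def mlCommutator (n l : ℕ) (α : ℝ) (a : Fin l → Eucl n → ℝ)
    (f : Eucl n → ℝ) (x : Eucl n) : ℝ :=
  ∫ y, (∏ j, (a j x - a j y)) * f y * dist x y ^ (α - (n : ℝ))

end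

theorem two_rpow_add (a b : ℝ) : (2 : ℝ≥0∞) ^ (a + b) = 2 ^ a * 2 ^ b :=
  ENNReal.rpow_add a b (by norm_num) (by norm_num)

theorem two_rpow_ne_top (a : ℝ) : (2 : ℝ≥0∞) ^ a ≠ ⊤ :=
  ENNReal.rpow_ne_top_of_ne_zero (by norm_num) (by norm_num)

theorem two_rpow_ne_zero (a : ℝ) : (2 : ℝ≥0∞) ^ a ≠ 0 :=
  (ENNReal.rpow_pos (by norm_num) (by norm_num)).ne'

theorem two_rpow_mul_neg (a : ℝ) : (2 : ℝ≥0∞) ^ a * 2 ^ (-a) = 1 := by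
  rw [← two_rpow_add]; simp

/-- A nested family of partitions of ℝⁿ into cells: the cell of level `k` has measure `2^(-kn)`
and diameter at most `n 2^(-k)`. Two points lie in the same cell of level `k` iff they have the
same index `idx k`. -/
structure DyadicGrid (n : ℕ) where
  idx : ℤ → Eucl n → (Fin n → ℤ)
  measurable_idx : ∀ k, Measurable (idx k)
  nested : ∀ k x y, idx (k + 1) x = idx (k + 1) y → idx k x = idx k y
  volume_fiber : ∀ k x, volume {y | idx k y = idx k x} = (2 : ℝ≥0∞) ^ (-((k : ℝ) * n))
  dist_le : ∀ k x y, idx k x = idx k y → dist x y ≤ n * (2 : ℝ) ^ (-(k : ℝ))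

namespace DyadicGrid

variable {n : ℕ} (G : DyadicGrid n)

/-- The cell of level `k` containing `x`. -/
def cell (k : ℤ) (x : Eucl n) : Set (Eucl n) := {y | G.idx k y = G.idx k x}

/-- The average of `g` over the cell of level `k` containing `x`. -/
noncomputable def avg (k : ℤ) (g : Eucl n → ℝ≥0∞) (x : Eucl n) : ℝ≥0∞ :=
  2 ^ ((k : ℝ) * n) * ∫⁻ y in G.cell k x, g y

/-- `w` is constant on the cells of level `k`. -/
def CellConst {β : Type*} (k : ℤ) (w : Eucl n → β) : Prop :=
  ∀ x y, G.idx k x = G.idx k y → w x = w y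

theorem measurableSet_cell (k : ℤ) (x : Eucl n) : MeasurableSet (G.cell k x) :=
  G.measurable_idx k (measurableSet_singleton (G.idx k x))

theorem mem_cell {k : ℤ} {x y : Eucl n} : y ∈ G.cell k x ↔ G.idx k y = G.idx k x := Iff.rfl

theorem volume_cell (k : ℤ) (x : Eucl n) :
    volume (G.cell k x) = (2 : ℝ≥0∞) ^ (-((k : ℝ) * n)) := G.volume_fiber k x

theorem cell_congr {k : ℤ} {x y : Eucl n} (h : G.idx k x = G.idx k y) :
    G.cell k x = G.cell k y := by
  simp only [cell, h]

theorem idx_congr_of_le {j k : ℤ} (hjk : j ≤ k) {x y : Eucl n}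
    (h : G.idx k x = G.idx k y) : G.idx j x = G.idx j y := by
  induction k, hjk using Int.leInduction with
  | base => exact h
  | succ k _ ih => exact ih (G.nested k x y h)

theorem cell_subset_of_le {j k : ℤ} (hjk : j ≤ k) (x : Eucl n) : G.cell k x ⊆ G.cell j x :=
  fun _ hy => G.idx_congr_of_le hjk hy

variable {G}

theorem CellConst.mono {β : Type*} {j k : ℤ} (hjk : j ≤ k) {w : Eucl n → β}
    (h : G.CellConst j w) : G.CellConst k w :=
  fun x y hxy => h x y (G.idx_congr_of_le hjk hxy)

theorem CellConst.measurable {β : Type*} [MeasurableSpace β] {k : ℤ} {w : Eucl n → β}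
    (h : G.CellConst k w) : Measurable w := by
  have hw : w = (Function.extend (G.idx k) w fun _ => w 0) ∘ G.idx k := by
    refine (Function.FactorsThrough.extend_comp (fun _ => w 0) ?_).symm
    exact fun x y hxy => h x y hxy
  rw [hw]
  exact (Measurable.of_discrete).comp (G.measurable_idx k)

variable (G)

theorem cellConst_avg (k : ℤ) (g : Eucl n → ℝ≥0∞) : G.CellConst k (G.avg k g) :=
  fun x y h => by simp only [avg, G.cell_congr h]

theorem measurable_avg (k : ℤ) (g : Eucl n → ℝ≥0∞) : Measurable (G.avg k g) :=
  (G.cellConst_avg k g).measurable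

theorem avg_mono (k : ℤ) {g h : Eucl n → ℝ≥0∞} (x : Eucl n)
    (hgh : ∀ y ∈ G.cell k x, g y ≤ h y) : G.avg k g x ≤ G.avg k h x :=
  mul_le_mul_right (setLIntegral_mono' (G.measurableSet_cell k x) hgh) _

theorem avg_const (k : ℤ) (a : ℝ≥0∞) (x : Eucl n) : G.avg k (fun _ => a) x = a := by
  simp only [avg, lintegral_const, Measure.restrict_apply_univ, volume_cell]
  rw [mul_left_comm, two_rpow_mul_neg, mul_one]

theorem avg_const_mul (k : ℤ) {a : ℝ≥0∞} (ha : a ≠ ⊤) (g : Eucl n → ℝ≥0∞) (x : Eucl n) :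
    G.avg k (fun y => a * g y) x = a * G.avg k g x := by
  simp only [avg]
  rw [lintegral_const_mul' _ _ ha, mul_left_comm]

theorem avg_add (k : ℤ) {g : Eucl n → ℝ≥0∞} (hg : Measurable g) (h : Eucl n → ℝ≥0∞)
    (x : Eucl n) : G.avg k (fun y => g y + h y) x = G.avg k g x + G.avg k h x := by
  simp only [avg]
  rw [lintegral_add_left hg, mul_add]

theorem setLIntegral_cell (k : ℤ) (g : Eucl n → ℝ≥0∞) (x : Eucl n) :
    ∫⁻ y in G.cell k x, g y = 2 ^ (-((k : ℝ) * n)) * G.avg k g x := by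
  rw [avg, ← mul_assoc, mul_comm ((2 : ℝ≥0∞) ^ _), two_rpow_mul_neg, one_mul]

theorem avg_le_of_succ (k : ℤ) (g : Eucl n → ℝ≥0∞) (x : Eucl n) :
    G.avg (k + 1) g x ≤ 2 ^ (n : ℝ) * G.avg k g x := by
  simp only [avg]
  rw [← mul_assoc, ← two_rpow_add]
  have : (n : ℝ) + k * n = ((k + 1 : ℤ) : ℝ) * n := by push_cast; ring
  rw [this]
  exact mul_le_mul_right (lintegral_mono_set (G.cell_subset_of_le (by omega) x)) _

theorem lintegral_eq_tsum (k : ℤ) (h : Eucl n → ℝ≥0∞) :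
    ∫⁻ x, h x = ∑' m : Fin n → ℤ, ∫⁻ x in G.idx k ⁻¹' {m}, h x := by
  rw [← lintegral_iUnion]
  · rw [← Set.preimage_iUnion, Set.iUnion_of_singleton, Set.preimage_univ, setLIntegral_univ]
  · exact fun m => G.measurable_idx k (measurableSet_singleton m)
  · intro a b hab
    exact Disjoint.preimage _ (by simpa using hab)

/-- Averaging over cells is self-adjoint against functions constant on cells. -/
theorem lintegral_mul_avg {k : ℤ} {w : Eucl n → ℝ≥0∞} (hw : G.CellConst k w)
    {g : Eucl n → ℝ≥0∞} (hg : Measurable g) :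
    ∫⁻ x, w x * G.avg k g x = ∫⁻ x, w x * g x := by
  rw [G.lintegral_eq_tsum k, G.lintegral_eq_tsum k]
  refine tsum_congr fun m => ?_
  by_cases hm : ∃ x, G.idx k x = m
  · obtain ⟨x, rfl⟩ := hm
    change ∫⁻ y in G.cell k x, _ = ∫⁻ y in G.cell k x, _
    have h1 : ∫⁻ y in G.cell k x, w y * G.avg k g y
        = ∫⁻ y in G.cell k x, w x * G.avg k g x :=
      setLIntegral_congr_fun (G.measurableSet_cell k x) fun y hy => by
        simp only [hw y x hy, G.cellConst_avg k g y x hy]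
    have h2 : ∫⁻ y in G.cell k x, w y * g y = ∫⁻ y in G.cell k x, w x * g y :=
      setLIntegral_congr_fun (G.measurableSet_cell k x) fun y hy => by
        simp only [hw y x hy]
    rw [h1, h2, lintegral_const_mul _ hg, lintegral_const, G.setLIntegral_cell,
      Measure.restrict_apply_univ, volume_cell]
    ring
  · have : G.idx k ⁻¹' {m} = ∅ := by
      ext x; simpa using fun h => hm ⟨x, h⟩
    simp [this]

/-- `E` is a union of cells of level `k`. -/
def CellUnion (k : ℤ) (E : Set (Eucl n)) : Prop := G.CellConst k (· ∈ E)

variable {G}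

theorem CellUnion.mono {j k : ℤ} (hjk : j ≤ k) {E : Set (Eucl n)} (h : G.CellUnion j E) :
    G.CellUnion k E := CellConst.mono hjk h

theorem CellUnion.measurableSet {k : ℤ} {E : Set (Eucl n)} (h : G.CellUnion k E) :
    MeasurableSet E := measurableSet_setOfPred.2 (CellConst.measurable h)

theorem CellUnion.cellConst_indicator {k : ℤ} {E : Set (Eucl n)} (h : G.CellUnion k E) :
    G.CellConst k (E.indicator (1 : Eucl n → ℝ≥0∞)) := fun x y hxy => by
  have := h x y hxy
  simp only [eq_iff_iff] at this
  by_cases hx : x ∈ E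
  · simp [hx, this.1 hx]
  · have hy : y ∉ E := fun hy => hx (this.2 hy)
    simp [hx, hy]

theorem cellUnion_disjointed {k₀ : ℤ} {A : ℕ → Set (Eucl n)}
    (hA : ∀ i : ℕ, G.CellUnion (k₀ + i) (A i)) (i : ℕ) :
    G.CellUnion (k₀ + i) (disjointed A i) := by
  intro x y hxy
  have h : ∀ j ≤ i, (x ∈ A j ↔ y ∈ A j) := fun j hj =>
    eq_iff_iff.1 ((hA j).mono (by omega) x y hxy)
  simp only [disjointed_eq_inter_compl, Set.mem_inter_iff, Set.mem_iInter, Set.mem_compl_iff,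
    eq_iff_iff]
  constructor
  · rintro ⟨h1, h2⟩
    exact ⟨(h i le_rfl).1 h1, fun j hj hy => h2 j hj ((h j hj.le).2 hy)⟩
  · rintro ⟨h1, h2⟩
    exact ⟨(h i le_rfl).2 h1, fun j hj hy => h2 j hj ((h j hj.le).1 hy)⟩

theorem CellUnion.setLIntegral_avg {k : ℤ} {E : Set (Eucl n)} (h : G.CellUnion k E)
    {g : Eucl n → ℝ≥0∞} (hg : Measurable g) :
    ∫⁻ x in E, G.avg k g x = ∫⁻ x in E, g x := by
  have := G.lintegral_mul_avg h.cellConst_indicator hg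
  rw [← lintegral_indicator h.measurableSet, ← lintegral_indicator h.measurableSet]
  simpa only [← Set.indicator_mul_left, Pi.one_apply, one_mul] using this

variable (G)

/-- The dyadic maximal function over cells of level at least `k₀`. -/
noncomputable def maxFn (k₀ : ℤ) (g : Eucl n → ℝ≥0∞) (x : Eucl n) : ℝ≥0∞ :=
  ⨆ i : ℕ, G.avg (k₀ + i) g x

theorem measurable_maxFn (k₀ : ℤ) (g : Eucl n → ℝ≥0∞) : Measurable (G.maxFn k₀ g) :=
  Measurable.iSup fun _ => G.measurable_avg _ g

theorem avg_le_maxFn (k₀ : ℤ) (i : ℕ) (g : Eucl n → ℝ≥0∞) (x : Eucl n) :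
    G.avg (k₀ + i) g x ≤ G.maxFn k₀ g x := le_iSup (fun i : ℕ => G.avg (k₀ + i) g x) i

theorem cellUnion_lt_avg (k : ℤ) (g : Eucl n → ℝ≥0∞) (a : ℝ≥0∞) :
    G.CellUnion k {x | a < G.avg k g x} := fun x y hxy => by
  simp only [Set.mem_ofPred_eq, G.cellConst_avg k g x y hxy]

/-- Weak type (1,1) inequality for the dyadic maximal function. -/
theorem mul_volume_lt_maxFn_le (k₀ : ℤ) {g : Eucl n → ℝ≥0∞} (hg : Measurable g) (a : ℝ≥0∞) :
    a * volume {x | a < G.maxFn k₀ g x} ≤ ∫⁻ x, g x := by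
  set A : ℕ → Set (Eucl n) := fun i => {x | a < G.avg (k₀ + i) g x}
  have hA : ∀ i : ℕ, G.CellUnion (k₀ + i) (A i) := fun i => G.cellUnion_lt_avg _ g a
  have hD := cellUnion_disjointed hA
  have hU : {x | a < G.maxFn k₀ g x} = ⋃ i, disjointed A i := by
    rw [iUnion_disjointed]
    ext x
    simp [A, maxFn, lt_iSup_iff]
  rw [hU, measure_iUnion (disjoint_disjointed A) (fun i => (hD i).measurableSet),
    ← ENNReal.tsum_mul_left]
  calc ∑' i, a * volume (disjointed A i)
      ≤ ∑' i, ∫⁻ x in disjointed A i, g x := by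
        refine ENNReal.tsum_le_tsum fun i => ?_
        rw [← (hD i).setLIntegral_avg hg, ← setLIntegral_const]
        exact setLIntegral_mono' (hD i).measurableSet fun x hx =>
          (disjointed_subset A i hx).le
    _ = ∫⁻ x in ⋃ i, disjointed A i, g x :=
        (lintegral_iUnion (fun i => (hD i).measurableSet) (disjoint_disjointed A) _).symm
    _ ≤ ∫⁻ x, g x := setLIntegral_le_lintegral _ _

end DyadicGrid

theorem two_rpow_mono {a b : ℝ} (h : a ≤ b) : (2 : ℝ≥0∞) ^ a ≤ 2 ^ b :=
  ENNReal.rpow_le_rpow_of_exponent_le (by norm_num) h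

theorem two_rpow_lt {a b : ℝ} (h : a < b) : (2 : ℝ≥0∞) ^ a < 2 ^ b :=
  ENNReal.rpow_lt_rpow_of_exponent_lt (by norm_num) (by norm_num) h

theorem two_rpow_lt_iff {a b : ℝ} : (2 : ℝ≥0∞) ^ a < 2 ^ b ↔ a < b :=
  ⟨fun h => lt_of_not_ge fun h' => (two_rpow_mono h').not_gt h, two_rpow_lt⟩

theorem exists_eq_two_rpow {y : ℝ≥0∞} (h0 : y ≠ 0) (ht : y ≠ ⊤) : ∃ κ : ℝ, y = 2 ^ κ := by
  have hy : 0 < y.toReal := ENNReal.toReal_pos h0 ht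
  refine ⟨Real.logb 2 y.toReal, ?_⟩
  rw [← ENNReal.ofReal_toReal ht, ← ENNReal.ofReal_ofNat 2,
    ENNReal.ofReal_rpow_of_pos (by norm_num), ENNReal.toReal_ofReal hy.le,
    Real.rpow_logb (by norm_num) (by norm_num) hy]

theorem tsum_nat_two_rpow_ne_top {δ : ℝ} (hδ : 0 < δ) :
    ∑' i : ℕ, (2 : ℝ≥0∞) ^ (-(δ * i)) ≠ ⊤ := by
  have h : ∀ i : ℕ, (2 : ℝ≥0∞) ^ (-(δ * i)) = ((2 : ℝ≥0∞) ^ (-δ)) ^ i := fun i => by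
    rw [← ENNReal.rpow_natCast, ← ENNReal.rpow_mul]; ring_nf
  simp_rw [h]
  rw [ENNReal.tsum_geometric, ENNReal.inv_ne_top]
  have : (2 : ℝ≥0∞) ^ (-δ) < 1 := by
    have := two_rpow_lt (neg_lt_zero.2 hδ); simpa using this
  exact (tsub_pos_of_lt this).ne'

/-- The sum of a two-sided geometric series. -/
noncomputable def geomSum (δ : ℝ) : ℝ≥0∞ := ∑' m : ℤ, (2 : ℝ≥0∞) ^ (-(δ * |(m : ℝ)|))

theorem geomSum_ne_top {δ : ℝ} (hδ : 0 < δ) : geomSum δ ≠ ⊤ := by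
  rw [geomSum, tsum_of_nat_of_neg_add_one ENNReal.summable ENNReal.summable]
  refine ENNReal.add_ne_top.2 ⟨?_, ?_⟩
  · simpa using tsum_nat_two_rpow_ne_top hδ
  · refine ne_top_of_le_ne_top (tsum_nat_two_rpow_ne_top hδ) (ENNReal.tsum_le_tsum fun i => ?_)
    refine two_rpow_mono (neg_le_neg (mul_le_mul_of_nonneg_left ?_ hδ.le))
    push_cast
    rw [abs_neg, abs_of_nonneg (by positivity)]
    linarith

theorem tsum_two_rpow_abs_sub_le {δ : ℝ} (hδ : 0 < δ) (κ : ℝ) :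
    ∑' m : ℤ, (2 : ℝ≥0∞) ^ (-(δ * |(m : ℝ) - κ|)) ≤ 2 ^ δ * geomSum δ := by
  rw [geomSum, ← (Equiv.subRight ⌊κ⌋).tsum_eq fun m : ℤ => (2 : ℝ≥0∞) ^ (-(δ * |(m : ℝ)|)),
    ← ENNReal.tsum_mul_left]
  refine ENNReal.tsum_le_tsum fun m => ?_
  rw [← two_rpow_add]
  refine two_rpow_mono ?_
  have h1 : |(m : ℝ) - ⌊κ⌋| ≤ |(m : ℝ) - κ| + 1 := by
    have : (m : ℝ) - ⌊κ⌋ = (m - κ) + (κ - ⌊κ⌋) := by ring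
    rw [this]
    refine (abs_add_le _ _).trans (add_le_add_right ?_ _)
    rw [abs_of_nonneg (sub_nonneg.2 (Int.floor_le κ))]
    linarith [Int.lt_floor_add_one κ]
  have h2 := mul_le_mul_of_nonneg_left h1 hδ.le
  simp only [Equiv.subRight_apply, Int.cast_sub]
  linarith

theorem rpow_le_tsum_levels {r : ℝ} (hr : 0 < r) (y : ℝ≥0∞) :
    y ^ r ≤ ∑' m : ℤ, (2 : ℝ≥0∞) ^ (((m : ℝ) + 2) * r) *
      (if 2 ^ ((m : ℝ) + 1) < y then 1 else 0) := by
  by_cases h0 : y = 0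
  · simp [h0, hr]
  by_cases ht : y = ⊤
  · subst ht
    refine le_trans le_top (le_of_eq (Eq.symm ?_))
    rw [eq_top_iff]
    refine (ENNReal.tsum_const_eq_top_of_ne_zero (α := ℕ)
      (one_ne_zero (α := ℝ≥0∞))).symm.le.trans ?_
    refine le_trans (ENNReal.tsum_le_tsum fun i => ?_)
      (ENNReal.tsum_comp_le_tsum_of_injective (f := fun i : ℕ => (i : ℤ))
        Nat.cast_injective _)
    have : (2 : ℝ≥0∞) ^ (((i : ℤ) : ℝ) + 1) < ⊤ := (two_rpow_ne_top _).lt_top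
    change (1 : ℝ≥0∞) ≤ 2 ^ ((((i : ℤ) : ℝ) + 2) * r) *
      (if (2 : ℝ≥0∞) ^ (((i : ℤ) : ℝ) + 1) < ⊤ then 1 else 0)
    rw [if_pos this, mul_one]
    have := two_rpow_mono (a := 0) (b := (((i : ℤ) : ℝ) + 2) * r) (by push_cast; positivity)
    simpa using this
  obtain ⟨κ, rfl⟩ := exists_eq_two_rpow h0 ht
  refine le_trans ?_ (ENNReal.le_tsum (⌈κ⌉ - 2))
  have h1 : (2 : ℝ≥0∞) ^ (((⌈κ⌉ - 2 : ℤ) : ℝ) + 1) < 2 ^ κ := two_rpow_lt (by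
    push_cast; linarith [Int.ceil_lt_add_one κ])
  rw [if_pos h1, mul_one, ← ENNReal.rpow_mul]
  refine two_rpow_mono (mul_le_mul_of_nonneg_right ?_ hr.le)
  push_cast; linarith [Int.le_ceil κ]

theorem tsum_levels_mul_le {r : ℝ} (hr : 1 < r) (y : ℝ≥0∞) :
    (∑' m : ℤ, (2 : ℝ≥0∞) ^ ((m : ℝ) * (r - 1)) * (if 2 ^ (m : ℝ) < y then 1 else 0)) * y ≤
      (2 ^ (r - 1) * geomSum (r - 1)) * y ^ r := by
  have hr' : 0 < r - 1 := sub_pos.2 hr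
  by_cases h0 : y = 0
  · simp [h0]
  by_cases ht : y = ⊤
  · subst ht
    rw [ENNReal.top_rpow_of_pos (by linarith),
      ENNReal.mul_top (a := 2 ^ (r - 1) * geomSum (r - 1))]
    · exact le_top
    · refine mul_ne_zero (two_rpow_ne_zero _) fun h => ?_
      rw [geomSum, ENNReal.tsum_eq_zero] at h
      exact two_rpow_ne_zero _ (h 0)
  obtain ⟨κ, rfl⟩ := exists_eq_two_rpow h0 ht
  have h1 : (∑' m : ℤ, (2 : ℝ≥0∞) ^ ((m : ℝ) * (r - 1)) *
      (if (2 : ℝ≥0∞) ^ (m : ℝ) < 2 ^ κ then 1 else 0)) ≤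
      2 ^ (κ * (r - 1)) * (2 ^ (r - 1) * geomSum (r - 1)) := by
    refine le_trans ?_ (mul_le_mul_right (tsum_two_rpow_abs_sub_le hr' κ) _)
    rw [← ENNReal.tsum_mul_left]
    refine ENNReal.tsum_le_tsum fun m => ?_
    rw [← two_rpow_add]
    split_ifs with h
    · rw [mul_one]
      refine two_rpow_mono (le_of_eq ?_)
      rw [abs_of_nonpos (by linarith [two_rpow_lt_iff.1 h])]
      ring
    · simp
  refine (mul_le_mul_left h1 _).trans (le_of_eq ?_)
  have : (2 : ℝ≥0∞) ^ κ * 2 ^ (κ * (r - 1)) = (2 ^ κ) ^ r := by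
    rw [← two_rpow_add, ← ENNReal.rpow_mul]; ring_nf
  rw [← this]; ring

/-- A Hedberg-type interpolation of a geometric bound and a uniform bound. -/
theorem tsum_two_rpow_mul_le {α σ : ℝ} (hα : 0 < α) (hσ : 0 < σ) (k₀ : ℤ) (M : ℝ≥0∞)
    (F : ℤ → ℝ≥0∞) (hF : ∀ k : ℤ, F k ≤ 2 ^ ((k : ℝ) * (α + σ)))
    (hM : ∀ i : ℕ, F (k₀ + i) ≤ M) :
    ∑' i : ℕ, 2 ^ (-(((k₀ + i : ℤ) : ℝ) * α)) * F (k₀ + i) ≤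
      (2 ^ min α σ * geomSum (min α σ)) * M ^ (σ / (α + σ)) := by
  have hδ : 0 < min α σ := lt_min hα hσ
  have hpos : 0 < σ / (α + σ) := by positivity
  by_cases h0 : M = 0
  · have : ∀ i : ℕ, F (k₀ + i) = 0 := fun i => le_antisymm ((hM i).trans h0.le) bot_le
    simp [this]
  by_cases ht : M = ⊤
  · subst ht
    rw [ENNReal.top_rpow_of_pos hpos, ENNReal.mul_top]
    · exact le_top
    · refine mul_ne_zero (two_rpow_ne_zero _) fun h => ?_
      rw [geomSum, ENNReal.tsum_eq_zero] at h
      exact two_rpow_ne_zero _ (h 0)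
  obtain ⟨κ', rfl⟩ := exists_eq_two_rpow h0 ht
  obtain ⟨κ, rfl⟩ : ∃ κ, κ' = κ * (α + σ) := ⟨κ' / (α + σ), by field_simp⟩
  have hexp : ((2 : ℝ≥0∞) ^ (κ * (α + σ))) ^ (σ / (α + σ)) = 2 ^ (κ * σ) := by
    rw [← ENNReal.rpow_mul]; congr 1; field_simp
  rw [hexp, mul_comm]
  refine le_trans ?_ (mul_le_mul_right (tsum_two_rpow_abs_sub_le hδ κ) _)
  rw [← ENNReal.tsum_mul_left]
  have hinj : Function.Injective fun i : ℕ => k₀ + (i : ℤ) := fun i j hij => by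
    simpa using hij
  refine le_trans (ENNReal.tsum_le_tsum fun i => ?_)
    (ENNReal.tsum_comp_le_tsum_of_injective hinj _)
  rw [← two_rpow_add]
  set k : ℤ := k₀ + i
  rcases le_total (k : ℝ) κ with h | h
  · refine (mul_le_mul_right (hF k) _).trans ?_
    rw [← two_rpow_add]
    refine two_rpow_mono ?_
    rw [abs_of_nonpos (by linarith)]
    nlinarith [min_le_right α σ, mul_le_mul_of_nonneg_right (min_le_right α σ) (sub_nonneg.2 h)]
  · refine (mul_le_mul_right (hM i) _).trans ?_
    rw [← two_rpow_add]
    refine two_rpow_mono ?_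
    rw [abs_of_nonneg (by linarith)]
    nlinarith [min_le_left α σ, mul_le_mul_of_nonneg_right (min_le_left α σ) (sub_nonneg.2 h)]

namespace DyadicGrid

variable {n : ℕ} (G : DyadicGrid n)

theorem mul_volume_two_mul_lt_maxFn_le (k₀ : ℤ) {g : Eucl n → ℝ≥0∞} (hg : Measurable g)
    {a : ℝ≥0∞} (ha : a ≠ ⊤) :
    a * volume {x | a + a < G.maxFn k₀ g x} ≤ ∫⁻ x, (if a < g x then 1 else 0) * g x := by
  set g₁ : Eucl n → ℝ≥0∞ := fun x => (if a < g x then 1 else 0) * g x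
  have hg₁ : Measurable g₁ :=
    (Measurable.ite (measurableSet_lt measurable_const hg) measurable_const
      measurable_const).mul hg
  refine le_trans (mul_le_mul_right (measure_mono fun x hx => ?_) _)
    (G.mul_volume_lt_maxFn_le k₀ hg₁ a)
  have h1 : G.maxFn k₀ g x ≤ G.maxFn k₀ g₁ x + a := by
    refine iSup_le fun i => ?_
    refine le_trans ?_ (add_le_add_left (G.avg_le_maxFn k₀ i g₁ x) a)
    rw [← G.avg_const (k₀ + i) a x, ← G.avg_add _ hg₁]
    refine G.avg_mono _ x fun y _ => ?_
    simp only [g₁]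
    split_ifs with h
    · simp
    · simpa using h
  exact (ENNReal.add_lt_add_iff_right ha).1 (lt_of_lt_of_le hx h1)

/-- The dyadic maximal function is bounded on `L^r` for `r > 1`. -/
theorem exists_lintegral_maxFn_rpow_le {r : ℝ} (hr : 1 < r) :
    ∃ C : ℝ≥0∞, C ≠ ⊤ ∧ ∀ {n : ℕ} (G : DyadicGrid n) (k₀ : ℤ) (g : Eucl n → ℝ≥0∞),
      Measurable g → ∫⁻ x, G.maxFn k₀ g x ^ r ≤ C * ∫⁻ x, g x ^ r := by
  refine ⟨2 ^ (2 * r) * (2 ^ (r - 1) * geomSum (r - 1)), ?_, fun {n} G k₀ g hg => ?_⟩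
  · exact ENNReal.mul_ne_top (two_rpow_ne_top _)
      (ENNReal.mul_ne_top (two_rpow_ne_top _) (geomSum_ne_top (sub_pos.2 hr)))
  have hmeas : ∀ a : ℝ≥0∞, Measurable fun x => if a < g x then (1 : ℝ≥0∞) else 0 := fun a =>
    Measurable.ite (measurableSet_lt measurable_const hg) measurable_const measurable_const
  have hmeas' : ∀ a : ℝ≥0∞, Measurable fun x => if a < G.maxFn k₀ g x then (1 : ℝ≥0∞) else 0 :=
    fun a => Measurable.ite (measurableSet_lt measurable_const (G.measurable_maxFn k₀ g))
      measurable_const measurable_const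
  calc ∫⁻ x, G.maxFn k₀ g x ^ r
      ≤ ∫⁻ x, ∑' m : ℤ, (2 : ℝ≥0∞) ^ (((m : ℝ) + 2) * r) *
          (if 2 ^ ((m : ℝ) + 1) < G.maxFn k₀ g x then 1 else 0) :=
        lintegral_mono fun x => rpow_le_tsum_levels (by linarith) _
    _ = ∑' m : ℤ, (2 : ℝ≥0∞) ^ (((m : ℝ) + 2) * r) *
          volume {x | (2 : ℝ≥0∞) ^ ((m : ℝ) + 1) < G.maxFn k₀ g x} := by
        rw [lintegral_tsum fun m => ((hmeas' _).const_mul _).aemeasurable]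
        refine tsum_congr fun m => ?_
        rw [lintegral_const_mul _ (hmeas' _), ← lintegral_indicator_one
          (measurableSet_lt measurable_const (G.measurable_maxFn k₀ g))]
        congr 2 with x
        simp [Set.indicator]
    _ ≤ ∑' m : ℤ, 2 ^ (2 * r) * ∫⁻ x, (2 : ℝ≥0∞) ^ ((m : ℝ) * (r - 1)) *
          (if 2 ^ (m : ℝ) < g x then 1 else 0) * g x := by
        refine ENNReal.tsum_le_tsum fun m => ?_
        have h1 := G.mul_volume_two_mul_lt_maxFn_le k₀ hg (two_rpow_ne_top (m : ℝ))
        have h2 : (2 : ℝ≥0∞) ^ (m : ℝ) + 2 ^ (m : ℝ) = 2 ^ ((m : ℝ) + 1) := by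
          rw [two_rpow_add, ENNReal.rpow_one, mul_two]
        rw [h2] at h1
        have h3 : (2 : ℝ≥0∞) ^ (((m : ℝ) + 2) * r) =
            2 ^ (2 * r) * 2 ^ ((m : ℝ) * (r - 1)) * 2 ^ (m : ℝ) := by
          rw [← two_rpow_add, ← two_rpow_add]; ring_nf
        simp_rw [mul_assoc ((2 : ℝ≥0∞) ^ ((m : ℝ) * (r - 1)))]
        rw [lintegral_const_mul' _ _ (two_rpow_ne_top _), h3, mul_assoc, mul_assoc]
        gcongr
    _ = 2 ^ (2 * r) * ∫⁻ x, (∑' m : ℤ, (2 : ℝ≥0∞) ^ ((m : ℝ) * (r - 1)) *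
          (if 2 ^ (m : ℝ) < g x then 1 else 0)) * g x := by
        rw [ENNReal.tsum_mul_left]
        simp_rw [← ENNReal.tsum_mul_right]
        rw [lintegral_tsum]
        exact fun m => (((hmeas _).const_mul _).mul hg).aemeasurable
    _ ≤ 2 ^ (2 * r) * ∫⁻ x, (2 ^ (r - 1) * geomSum (r - 1)) * g x ^ r := by
        refine mul_le_mul_right (lintegral_mono fun x => ?_) _
        exact tsum_levels_mul_le hr _
    _ = _ := by
        rw [lintegral_const_mul _ (hg.pow_const r), ← mul_assoc]

end DyadicGrid

theorem le_rpow_of_le_mul_rpow_self {x y : ℝ≥0∞} {a b : ℝ} (hab : a + b = 1) (ha : 0 < a)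
    (hb : 0 < b) (hx : x ≠ ⊤) (h : x ≤ y * x ^ b) : x ≤ y ^ (1 / a) := by
  by_cases h0 : x = 0
  · simp [h0]
  have hxb0 : x ^ b ≠ 0 := (ENNReal.rpow_pos (pos_iff_ne_zero.2 h0) hx).ne'
  have hxbt : x ^ b ≠ ⊤ := ENNReal.rpow_ne_top_of_nonneg hb.le hx
  have h1 : x ^ a * x ^ b ≤ y * x ^ b := by
    rw [← ENNReal.rpow_add a b h0 hx, hab, ENNReal.rpow_one]; exact h
  have h2 := (ENNReal.mul_le_mul_iff_left hxb0 hxbt).1 h1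
  have h3 := ENNReal.rpow_le_rpow h2 (one_div_pos.2 ha).le
  rwa [← ENNReal.rpow_mul, mul_one_div_cancel ha.ne', ENNReal.rpow_one] at h3

theorem lintegral_tsum_rpow_le {X : Type*} [MeasurableSpace X] {μ : Measure X} {t : ℝ}
    (ht : 0 < t) {g : ℕ → X → ℝ≥0∞} (hg : ∀ i, Measurable (g i)) {K : ℝ≥0∞}
    (h : ∀ N : ℕ, ∫⁻ x, (∑ i ∈ Finset.range N, g i x) ^ t ∂μ ≤ K) :
    ∫⁻ x, (∑' i, g i x) ^ t ∂μ ≤ K := by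
  have h1 : ∀ x, (∑' i, g i x) ^ t = ⨆ N : ℕ, (∑ i ∈ Finset.range N, g i x) ^ t := fun x => by
    rw [ENNReal.tsum_eq_iSup_nat]
    exact (ENNReal.orderIsoRpow t ht).map_iSup _
  simp_rw [h1]
  rw [lintegral_iSup]
  · exact iSup_le h
  · exact fun N => (Finset.measurable_sum _ fun i _ => hg i).pow_const t
  · intro a b hab x
    exact ENNReal.rpow_le_rpow (Finset.sum_le_sum_of_subset (Finset.range_mono hab)) ht.le

namespace DyadicGrid

variable {n : ℕ} (G : DyadicGrid n)

theorem avg_mul_le (k : ℤ) {v w : ℝ} (hvw : v.HolderConjugate w) {f g : Eucl n → ℝ≥0∞}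
    (hf : Measurable f) (hg : Measurable g) (x : Eucl n) :
    G.avg k (fun y => f y * g y) x ≤
      G.avg k (fun y => f y ^ v) x ^ (1 / v) * G.avg k (fun y => g y ^ w) x ^ (1 / w) := by
  have h := ENNReal.lintegral_mul_le_Lp_mul_Lq (volume.restrict (G.cell k x)) hvw
    hf.aemeasurable hg.aemeasurable
  have hv := hvw.nonneg
  have hw := hvw.symm.nonneg
  simp only [avg]
  rw [ENNReal.mul_rpow_of_nonneg _ _ (by positivity), ENNReal.mul_rpow_of_nonneg _ _ (by positivity),
    ← ENNReal.rpow_mul, ← ENNReal.rpow_mul]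
  have h2 : (2 : ℝ≥0∞) ^ ((k : ℝ) * n) =
      2 ^ ((k : ℝ) * n * (1 / v)) * 2 ^ ((k : ℝ) * n * (1 / w)) := by
    rw [← two_rpow_add, ← mul_add, one_div, one_div, hvw.inv_add_inv_eq_one, mul_one]
  rw [h2]
  refine (mul_le_mul_right h _).trans (le_of_eq ?_)
  ring

theorem avg_le_avg_rpow (k : ℤ) {v : ℝ} (hv : 1 ≤ v) {f : Eucl n → ℝ≥0∞}
    (hf : Measurable f) (x : Eucl n) :
    G.avg k f x ≤ G.avg k (fun y => f y ^ v) x ^ (1 / v) := by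
  rcases hv.eq_or_lt with rfl | hv
  · simp
  have h := G.avg_mul_le k (Real.HolderConjugate.conjExponent hv) hf
    (measurable_const (a := (1 : ℝ≥0∞))) x
  simpa [G.avg_const] using h

/-- Multiplying the terms of a sum of cell-constant functions by functions whose moments are
bounded on every cell does not increase the `L^t` norm by more than a constant. -/
theorem exists_lintegral_sum_mul_rpow_le {t : ℝ} (ht : 1 < t) {K : ℝ → ℝ≥0∞}
    (hK : ∀ r, K r ≠ ⊤) :
    ∃ C : ℝ≥0∞, C ≠ ⊤ ∧ ∀ {n : ℕ} (G : DyadicGrid n) (φ : ℤ → Eucl n → ℝ≥0∞),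
      (∀ k, Measurable (φ k)) →
      (∀ r, 1 ≤ r → ∀ k x, G.avg k (fun y => φ k y ^ r) x ≤ K r) →
      ∀ (k₀ : ℤ) (c : ℕ → Eucl n → ℝ≥0∞), (∀ i : ℕ, G.CellConst (k₀ + i) (c i)) → ∀ N : ℕ,
      ∫⁻ x, (∑ i ∈ Finset.range N, c i x * φ (k₀ + i) x) ^ t ≤
        C * ∫⁻ x, (∑ i ∈ Finset.range N, c i x) ^ t := by
  set t' := t.conjExponent with ht'
  have htt : t.HolderConjugate t' := Real.HolderConjugate.conjExponent ht
  have ht'1 : 1 < t' := htt.symm.lt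
  set v := (1 + t') / 2 with hv
  have hv1 : 1 < v := by rw [hv]; linarith
  have hvt : 1 < t' / v := by rw [one_lt_div (by linarith), hv]; linarith
  set v' := v.conjExponent with hv'
  have hvv : v.HolderConjugate v' := Real.HolderConjugate.conjExponent hv1
  have hv'1 : 1 < v' := hvv.symm.lt
  obtain ⟨CM, hCM, hmax⟩ := exists_lintegral_maxFn_rpow_le hvt
  set B : ℝ≥0∞ := K v' ^ (1 / v') * CM ^ (1 / t')
  have hB : B ≠ ⊤ := ENNReal.mul_ne_top
    (ENNReal.rpow_ne_top_of_nonneg (by positivity) (hK _))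
    (ENNReal.rpow_ne_top_of_nonneg (by positivity) hCM)
  refine ⟨(B + 1) ^ t, ENNReal.rpow_ne_top_of_nonneg (by linarith) (by simp [hB]),
    fun {n} G φ hφ hφK k₀ c hc N => ?_⟩
  set s := Finset.range N
  set h : Eucl n → ℝ≥0∞ := fun x => ∑ i ∈ s, c i x * φ (k₀ + i) x
  set S : Eucl n → ℝ≥0∞ := fun x => ∑ i ∈ s, c i x
  have hcm : ∀ i, Measurable (c i) := fun i => (hc i).measurable
  have hSm : Measurable S := Finset.measurable_sum _ fun i _ => hcm i
  have hhm : Measurable h := Finset.measurable_sum _ fun i _ => (hcm i).mul (hφ _)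
  change ∫⁻ x, h x ^ t ≤ _ * ∫⁻ x, S x ^ t
  set I := ∫⁻ x, h x ^ t with hI
  set J := ∫⁻ x, S x ^ t with hJ
  by_cases hJt : J = ⊤
  · rw [hJt, ENNReal.mul_top]
    · exact le_top
    · exact (ENNReal.rpow_pos (by simp) (by simp [hB])).ne'
  have hcS : ∀ i ∈ s, ∀ x, c i x ≤ S x := fun i hi x =>
    Finset.single_le_sum (f := fun i => c i x) (fun _ _ => bot_le) hi
  have hIt : I ≠ ⊤ := by
    refine ne_top_of_le_ne_top (b := (s.card : ℝ≥0∞) ^ (t - 1) * ∑ i ∈ s, K t * J) ?_ ?_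
    · refine ENNReal.mul_ne_top (ENNReal.rpow_ne_top_of_nonneg (by linarith) (by simp)) ?_
      exact ENNReal.sum_ne_top.2 fun i _ => ENNReal.mul_ne_top (hK t) hJt
    · calc I ≤ ∫⁻ x, (s.card : ℝ≥0∞) ^ (t - 1) * ∑ i ∈ s, (c i x * φ (k₀ + i) x) ^ t :=
            lintegral_mono fun x => ENNReal.rpow_sum_le_const_mul_sum_rpow s _ ht.le
        _ = (s.card : ℝ≥0∞) ^ (t - 1) * ∑ i ∈ s, ∫⁻ x, (c i x * φ (k₀ + i) x) ^ t := by
            rw [lintegral_const_mul, lintegral_finsetSum]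
            · exact fun i _ => ((hcm i).mul (hφ _)).pow_const t
            · exact Finset.measurable_sum _ fun i _ => ((hcm i).mul (hφ _)).pow_const t
        _ ≤ _ := by
            gcongr with i hi
            calc ∫⁻ x, (c i x * φ (k₀ + i) x) ^ t
                = ∫⁻ x, c i x ^ t * φ (k₀ + i) x ^ t := by
                  simp_rw [ENNReal.mul_rpow_of_nonneg _ _ (by linarith : (0 : ℝ) ≤ t)]
              _ = ∫⁻ x, c i x ^ t * G.avg (k₀ + i) (fun y => φ (k₀ + i) y ^ t) x := by
                  refine (G.lintegral_mul_avg (fun x y hxy => ?_) ((hφ _).pow_const t)).symm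
                  rw [hc i x y hxy]
              _ ≤ ∫⁻ x, S x ^ t * K t := by
                  gcongr with x
                  · exact hcS i hi x
                  · exact hφK t ht.le _ x
              _ = K t * J := by rw [lintegral_mul_const _ (hSm.pow_const t), mul_comm]
  set H : Eucl n → ℝ≥0∞ := fun x => h x ^ (t - 1)
  have hHm : Measurable H := hhm.pow_const _
  set W : Eucl n → ℝ≥0∞ := fun x => G.maxFn k₀ (fun y => H y ^ v) x ^ (1 / v)
  have hWm : Measurable W := (G.measurable_maxFn _ _).pow_const _
  have hW : ∫⁻ x, W x ^ t' ≤ CM * I := by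
    have h1 := hmax G k₀ (fun y => H y ^ v) (hHm.pow_const v)
    have h2 : ∀ y, (H y ^ v) ^ (t' / v) = h y ^ t := fun y => by
      simp only [H]
      rw [← ENNReal.rpow_mul, ← ENNReal.rpow_mul, mul_div_cancel₀ _ (by linarith : v ≠ 0),
        htt.sub_one_mul_conj]
    simp_rw [h2] at h1
    refine le_trans (le_of_eq ?_) h1
    refine lintegral_congr fun x => ?_
    simp only [W]
    rw [← ENNReal.rpow_mul]
    congr 1
    ring
  have key : I ≤ B * J ^ (1 / t) * I ^ (1 / t') := by
    calc I = ∫⁻ x, ∑ i ∈ s, c i x * (φ (k₀ + i) x * H x) := by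
          refine lintegral_congr fun x => ?_
          have : h x ^ t = h x * H x := by
            conv_lhs => rw [show t = 1 + (t - 1) by ring,
              ENNReal.rpow_add_of_nonneg _ _ zero_le_one (by linarith), ENNReal.rpow_one]
          rw [this]
          simp only [h, Finset.sum_mul, mul_assoc]
      _ = ∑ i ∈ s, ∫⁻ x, c i x * (φ (k₀ + i) x * H x) :=
          lintegral_finsetSum _ fun i _ => (hcm i).mul ((hφ _).mul hHm)
      _ ≤ ∑ i ∈ s, ∫⁻ x, K v' ^ (1 / v') * (c i x * W x) := by
          refine Finset.sum_le_sum fun i _ => ?_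
          refine (G.lintegral_mul_avg (hc i) (g := fun y => φ (k₀ + i) y * H y)
            ((hφ _).mul hHm)).symm.trans_le (lintegral_mono fun x => ?_)
          rw [mul_left_comm]
          gcongr
          refine (G.avg_mul_le (k₀ + i) hvv.symm (hφ _) hHm x).trans ?_
          gcongr
          · exact hφK v' hv'1.le _ x
          · exact ENNReal.rpow_le_rpow (G.avg_le_maxFn k₀ i _ x) (by positivity)
      _ = K v' ^ (1 / v') * ∫⁻ x, S x * W x := by
          have hne : K v' ^ (1 / v') ≠ ⊤ := ENNReal.rpow_ne_top_of_nonneg (by positivity) (hK _)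
          simp_rw [lintegral_const_mul' _ _ hne]
          rw [← Finset.mul_sum]
          congr 1
          refine (lintegral_finsetSum s fun i _ => (hcm i).mul hWm).symm.trans ?_
          exact lintegral_congr fun x => (Finset.sum_mul s _ _).symm
      _ ≤ K v' ^ (1 / v') * (J ^ (1 / t) * (CM * I) ^ (1 / t')) := by
          gcongr
          refine (ENNReal.lintegral_mul_le_Lp_mul_Lq volume htt hSm.aemeasurable
            hWm.aemeasurable).trans ?_
          gcongr
      _ = B * J ^ (1 / t) * I ^ (1 / t') := by
          rw [ENNReal.mul_rpow_of_nonneg _ _ (by positivity)]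
          simp only [B]; ring
  have h3 := le_rpow_of_le_mul_rpow_self (a := 1 / t) (b := 1 / t')
    (by rw [one_div, one_div]; exact htt.inv_add_inv_eq_one) (by positivity) (by positivity) hIt key
  refine h3.trans ?_
  rw [one_div_one_div, ENNReal.mul_rpow_of_nonneg _ _ (by linarith), ← ENNReal.rpow_mul,
    one_div_mul_cancel (by linarith), ENNReal.rpow_one]
  gcongr
  exact le_self_add

end DyadicGrid

namespace DyadicGrid

variable {n : ℕ} (G : DyadicGrid n)

theorem avg_le_of_le {j k : ℤ} (hjk : j ≤ k) (g : Eucl n → ℝ≥0∞) (x : Eucl n) :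
    G.avg k g x ≤ 2 ^ (((k : ℝ) - j) * n) * G.avg j g x := by
  simp only [avg]
  rw [← mul_assoc, ← two_rpow_add, ← add_mul, sub_add_cancel]
  gcongr
  exact G.cell_subset_of_le hjk x

/-- The contribution of the cells of level `k` to a dyadic fractional integral of `f`. -/
noncomputable def fracTerm (α u : ℝ) (φ : ℤ → Eucl n → ℝ≥0∞) (f : Eucl n → ℝ≥0∞) (k : ℤ)
    (x : Eucl n) : ℝ≥0∞ :=
  2 ^ (-((k : ℝ) * α)) * (G.avg k (fun y => f y ^ u) x ^ (1 / u) * φ k x)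

theorem measurable_fracTerm (α u : ℝ) {φ : ℤ → Eucl n → ℝ≥0∞} (hφ : ∀ k, Measurable (φ k))
    (f : Eucl n → ℝ≥0∞) (k : ℤ) : Measurable (G.fracTerm α u φ f k) :=
  (((G.measurable_avg k _).pow_const _).mul (hφ k)).const_mul _

theorem avg_rpow_le_two_rpow {u q τ : ℝ} (hu : 0 < u) (huq : u < q) {f : Eucl n → ℝ≥0∞}
    (hf : Measurable f) (k : ℤ) (x : Eucl n)
    (h : G.avg k (fun y => f y ^ q) x ≤ 2 ^ ((k : ℝ) * τ * q)) :
    G.avg k (fun y => f y ^ u) x ^ (1 / u) ≤ 2 ^ ((k : ℝ) * τ) := by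
  have hq : 0 < q := hu.trans huq
  have h1 := G.avg_le_avg_rpow k (v := q / u) ((one_le_div hu).2 huq.le) (hf.pow_const u) x
  simp_rw [← ENNReal.rpow_mul, mul_div_cancel₀ q hu.ne'] at h1
  calc G.avg k (fun y => f y ^ u) x ^ (1 / u)
      ≤ ((2 ^ ((k : ℝ) * τ * q)) ^ (1 / (q / u))) ^ (1 / u) := by
        gcongr
        refine h1.trans ?_
        gcongr
    _ = 2 ^ ((k : ℝ) * τ) := by
        rw [← ENNReal.rpow_mul, ← ENNReal.rpow_mul]
        congr 1
        field_simp

/-- The cells of level at least `k₀`. -/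
theorem exists_avg_tsum_fracTerm_add_rpow_le {α σ u q t : ℝ} (hα : 0 < α) (hσ : 0 < σ)
    (hu : 0 < u) (huq : u < q) (ht : 1 < t) (hqt : q * (α + σ) = t * σ) {K : ℝ → ℝ≥0∞}
    (hK : ∀ r, K r ≠ ⊤) :
    ∃ C : ℝ≥0∞, C ≠ ⊤ ∧ ∀ {n : ℕ} (G : DyadicGrid n) (φ : ℤ → Eucl n → ℝ≥0∞),
      (∀ k, Measurable (φ k)) →
      (∀ r, 1 ≤ r → ∀ k x, G.avg k (fun y => φ k y ^ r) x ≤ K r) →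
      ∀ f : Eucl n → ℝ≥0∞, Measurable f →
      (∀ k x, G.avg k (fun y => f y ^ q) x ≤ 2 ^ ((k : ℝ) * (α + σ) * q)) →
      ∀ (k₀ : ℤ) (x₀ : Eucl n),
      G.avg k₀ (fun x => (∑' i : ℕ, G.fracTerm α u φ f (k₀ + i) x) ^ t) x₀ ≤
        C * 2 ^ ((k₀ : ℝ) * σ * t) := by
  obtain ⟨C₁, hC₁, hmul⟩ := exists_lintegral_sum_mul_rpow_le ht hK
  obtain ⟨C₂, hC₂, hmax⟩ := exists_lintegral_maxFn_rpow_le ((one_lt_div hu).2 huq)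
  set A : ℝ≥0∞ := 2 ^ min α σ * geomSum (min α σ)
  have hA : A ≠ ⊤ := ENNReal.mul_ne_top (two_rpow_ne_top _) (geomSum_ne_top (lt_min hα hσ))
  have hAt : A ^ t ≠ ⊤ := ENNReal.rpow_ne_top_of_nonneg (by linarith) hA
  refine ⟨C₁ * (A ^ t * C₂), ENNReal.mul_ne_top hC₁ (ENNReal.mul_ne_top hAt hC₂),
    fun {n} G φ hφ hφK f hf hfq k₀ x₀ => ?_⟩
  have hq : 0 < q := hu.trans huq
  have hατ : 0 < α + σ := by linarith
  set E := G.cell k₀ x₀ with hE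
  have hEm : MeasurableSet E := G.measurableSet_cell k₀ x₀
  set f₁ : Eucl n → ℝ≥0∞ := E.indicator f with hf₁
  have hf₁m : Measurable f₁ := hf.indicator hEm
  have hf₁f : ∀ y, f₁ y ≤ f y := fun y => Set.indicator_le_self _ _ y
  set c : ℕ → Eucl n → ℝ≥0∞ := fun i x =>
    2 ^ (-(((k₀ + i : ℤ) : ℝ) * α)) * G.avg (k₀ + i) (fun y => f₁ y ^ u) x ^ (1 / u)
  have hc : ∀ i : ℕ, G.CellConst (k₀ + i) (c i) := fun i x y hxy => by
    simp only [c, G.cellConst_avg _ _ x y hxy]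
  have hE_eq : ∀ x ∈ E, ∀ i : ℕ,
      G.fracTerm α u φ f (k₀ + i) x = c i x * φ (k₀ + i) x := fun x hx i => by
    simp only [fracTerm, c, mul_assoc]
    have h : G.avg (k₀ + i) (fun y => f y ^ u) x = G.avg (k₀ + i) (fun y => f₁ y ^ u) x := by
      refine le_antisymm (G.avg_mono _ _ fun y hy => ?_)
        (G.avg_mono _ _ fun y _ => ENNReal.rpow_le_rpow (hf₁f y) hu.le)
      have : y ∈ E := by
        have := G.cell_subset_of_le (show k₀ ≤ k₀ + i by omega) x hy
        rwa [hE, ← G.cell_congr hx]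
      rw [hf₁, Set.indicator_of_mem this]
    rw [h]
  have hsum : ∀ x, ∑' i : ℕ, c i x ≤
      A * (G.maxFn k₀ (fun y => f₁ y ^ u) x ^ (1 / u)) ^ (σ / (α + σ)) := fun x => by
    refine tsum_two_rpow_mul_le hα hσ k₀ _
      (fun k => G.avg k (fun y => f₁ y ^ u) x ^ (1 / u)) (fun k => ?_) fun i => ?_
    · refine G.avg_rpow_le_two_rpow hu huq hf₁m k x ((G.avg_mono _ _ fun y _ => ?_).trans
        (hfq k x))
      exact ENNReal.rpow_le_rpow (hf₁f y) hq.le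
    · exact ENNReal.rpow_le_rpow (G.avg_le_maxFn _ _ _ _) (by positivity)
  have hmain : ∫⁻ x in E, (∑' i : ℕ, G.fracTerm α u φ f (k₀ + i) x) ^ t ≤
      C₁ * (A ^ t * (C₂ * ∫⁻ x in E, f x ^ q)) := by
    calc ∫⁻ x in E, (∑' i : ℕ, G.fracTerm α u φ f (k₀ + i) x) ^ t
        = ∫⁻ x in E, (∑' i : ℕ, c i x * φ (k₀ + i) x) ^ t :=
          setLIntegral_congr_fun hEm fun x hx => by simp only [hE_eq x hx]
      _ ≤ ∫⁻ x, (∑' i : ℕ, c i x * φ (k₀ + i) x) ^ t := setLIntegral_le_lintegral _ _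
      _ ≤ C₁ * ∫⁻ x, (∑' i : ℕ, c i x) ^ t := by
          refine lintegral_tsum_rpow_le (by linarith)
            (fun i => (hc i).measurable.mul (hφ _)) fun N => ?_
          refine (hmul G φ hφ hφK k₀ c hc N).trans ?_
          gcongr with x
          exact ENNReal.sum_le_tsum _
      _ ≤ C₁ * ∫⁻ x, A ^ t * G.maxFn k₀ (fun y => f₁ y ^ u) x ^ (q / u) := by
          gcongr with x
          refine (ENNReal.rpow_le_rpow (hsum x) (by linarith)).trans (le_of_eq ?_)
          rw [ENNReal.mul_rpow_of_nonneg _ _ (by linarith), ← ENNReal.rpow_mul,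
            ← ENNReal.rpow_mul]
          congr 2
          rw [show 1 / u * (σ / (α + σ) * t) = (t * σ) / (u * (α + σ)) by field_simp, ← hqt]
          field_simp
      _ ≤ _ := by
          rw [lintegral_const_mul' _ _ hAt]
          gcongr
          refine (hmax G k₀ (fun y => f₁ y ^ u) (hf₁m.pow_const u)).trans ?_
          rw [← lintegral_indicator hEm]
          gcongr with x
          rw [← ENNReal.rpow_mul, mul_div_cancel₀ q hu.ne']
          by_cases hx : x ∈ E
          · simp [hf₁, hx]
          · simp [hf₁, hx, hq]
  calc G.avg k₀ (fun x => (∑' i : ℕ, G.fracTerm α u φ f (k₀ + i) x) ^ t) x₀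
      ≤ 2 ^ ((k₀ : ℝ) * n) * (C₁ * (A ^ t * (C₂ * ∫⁻ x in E, f x ^ q))) :=
        mul_le_mul_right hmain _
    _ = C₁ * (A ^ t * C₂) * G.avg k₀ (fun y => f y ^ q) x₀ := by
        simp only [avg]; ring
    _ ≤ C₁ * (A ^ t * C₂) * 2 ^ ((k₀ : ℝ) * (α + σ) * q) := by gcongr; exact hfq k₀ x₀
    _ = _ := by
        congr 2
        linear_combination (k₀ : ℝ) * hqt

/-- The cells of level less than `k₀`. -/
theorem exists_avg_tsum_fracTerm_sub_rpow_le {α σ u q t : ℝ} (hσ : 0 < σ)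
    (hu : 0 < u) (huq : u < q) (ht : 1 < t) {K : ℝ → ℝ≥0∞} (hK : ∀ r, K r ≠ ⊤) (n : ℕ) :
    ∃ C : ℝ≥0∞, C ≠ ⊤ ∧ ∀ (G : DyadicGrid n) (φ : ℤ → Eucl n → ℝ≥0∞),
      (∀ k, Measurable (φ k)) →
      (∀ r, 1 ≤ r → ∀ k x, G.avg k (fun y => φ k y ^ r) x ≤ K r) →
      ∀ f : Eucl n → ℝ≥0∞, Measurable f →
      (∀ k x, G.avg k (fun y => f y ^ q) x ≤ 2 ^ ((k : ℝ) * (α + σ) * q)) →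
      ∀ (k₀ : ℤ) (x₀ : Eucl n),
      G.avg k₀ (fun x => (∑' i : ℕ, G.fracTerm α u φ f (k₀ - 1 - i) x) ^ t) x₀ ≤
        C * 2 ^ ((k₀ : ℝ) * σ * t) := by
  set R : ℝ := 1 + 2 * n / σ with hR
  have hR1 : 1 ≤ R := by rw [hR]; have : 0 ≤ 2 * n / σ := by positivity
                         linarith
  have hR0 : 0 < R := by linarith
  have ht0 : 0 < t := by linarith
  have hnR : n / R ≤ σ / 2 := by
    rw [div_le_iff₀ hR0, hR]
    have : σ / 2 * (1 + 2 * n / σ) = σ / 2 + n := by field_simp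
    linarith
  set S : ℝ → ℝ≥0∞ := fun δ => ∑' i : ℕ, 2 ^ (-(δ * i))
  have hS : ∀ δ, 0 < δ → S δ ≠ ⊤ := fun δ hδ => tsum_nat_two_rpow_ne_top hδ
  have hKR : K (t * R) ^ (1 / R) ≠ ⊤ := ENNReal.rpow_ne_top_of_nonneg (by positivity) (hK _)
  refine ⟨S σ ^ (t - 1) * (K (t * R) ^ (1 / R) * S (σ / 2)),
    ENNReal.mul_ne_top (ENNReal.rpow_ne_top_of_nonneg (by linarith) (hS σ hσ))
      (ENNReal.mul_ne_top hKR (hS _ (by positivity))),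
    fun G φ hφ hφK f hf hfq k₀ x₀ => ?_⟩
  set w : ℕ → ℝ≥0∞ := fun i => 2 ^ (-(σ * ((i : ℝ) + 1))) with hw
  have hw_ne : ∀ i, w i ≠ ⊤ := fun i => two_rpow_ne_top _
  have hwS : ∀ N : ℕ, ∑ i ∈ Finset.range N, w i ≤ S σ := fun N =>
    (ENNReal.sum_le_tsum _).trans (ENNReal.tsum_le_tsum fun i => two_rpow_mono (by nlinarith))
  have hterm : ∀ (i : ℕ) x, G.fracTerm α u φ f (k₀ - 1 - i) x ≤
      2 ^ ((k₀ : ℝ) * σ) * (w i * φ (k₀ - 1 - i) x) := fun i x => by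
    have h1 := G.avg_rpow_le_two_rpow hu huq hf (k₀ - 1 - i) x (hfq _ x)
    calc G.fracTerm α u φ f (k₀ - 1 - i) x
        ≤ 2 ^ (-(((k₀ - 1 - i : ℤ) : ℝ) * α)) *
          (2 ^ (((k₀ - 1 - i : ℤ) : ℝ) * (α + σ)) * φ (k₀ - 1 - i) x) := by
          simp only [fracTerm]; gcongr
      _ = _ := by
          rw [← mul_assoc, ← mul_assoc, hw, ← two_rpow_add, ← two_rpow_add]
          push_cast
          ring_nf
  have hφt : ∀ i : ℕ, G.avg k₀ (fun y => φ (k₀ - 1 - i) y ^ t) x₀ ≤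
      2 ^ (σ / 2 * ((i : ℝ) + 1)) * K (t * R) ^ (1 / R) := fun i => by
    have h1 := G.avg_le_avg_rpow k₀ hR1 ((hφ (k₀ - 1 - i)).pow_const t) x₀
    simp_rw [← ENNReal.rpow_mul] at h1
    have h2 := G.avg_le_of_le (show k₀ - 1 - i ≤ k₀ by omega)
      (fun y => φ (k₀ - 1 - i) y ^ (t * R)) x₀
    have h3 := hφK (t * R) (by nlinarith) (k₀ - 1 - i) x₀
    calc G.avg k₀ (fun y => φ (k₀ - 1 - i) y ^ t) x₀
        ≤ (2 ^ (((k₀ : ℝ) - (k₀ - 1 - i : ℤ)) * n) * K (t * R)) ^ (1 / R) := by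
          refine h1.trans ?_
          gcongr
          refine h2.trans ?_
          gcongr
      _ = 2 ^ (((i : ℝ) + 1) * (n / R)) * K (t * R) ^ (1 / R) := by
          rw [ENNReal.mul_rpow_of_nonneg _ _ (by positivity), ← ENNReal.rpow_mul]
          push_cast
          ring_nf
      _ ≤ _ := by
          refine mul_le_mul_left (two_rpow_mono ?_) _
          nlinarith [(Nat.cast_nonneg i : (0 : ℝ) ≤ i)]
  have hpart : ∀ N : ℕ, ∫⁻ x in G.cell k₀ x₀,
      (∑ i ∈ Finset.range N, w i * φ (k₀ - 1 - i) x) ^ t ≤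
      2 ^ (-((k₀ : ℝ) * n)) * (S σ ^ (t - 1) * (K (t * R) ^ (1 / R) * S (σ / 2))) := fun N => by
    have hm : ∀ i : ℕ, Measurable fun x => φ (k₀ - 1 - i) x ^ t := fun i =>
      (hφ _).pow_const t
    calc ∫⁻ x in G.cell k₀ x₀, (∑ i ∈ Finset.range N, w i * φ (k₀ - 1 - i) x) ^ t
        ≤ ∫⁻ x in G.cell k₀ x₀, S σ ^ (t - 1) *
          ∑ i ∈ Finset.range N, w i * φ (k₀ - 1 - i) x ^ t := by
          gcongr with x
          have h := ENNReal.inner_le_weight_mul_Lp_of_nonneg (Finset.range N) ht.le w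
            (fun i => φ (k₀ - 1 - i) x)
          calc (∑ i ∈ Finset.range N, w i * φ (k₀ - 1 - i) x) ^ t
              ≤ ((∑ i ∈ Finset.range N, w i) ^ (1 - t⁻¹) *
                (∑ i ∈ Finset.range N, w i * φ (k₀ - 1 - i) x ^ t) ^ t⁻¹) ^ t := by gcongr
            _ = (∑ i ∈ Finset.range N, w i) ^ (t - 1) *
                ∑ i ∈ Finset.range N, w i * φ (k₀ - 1 - i) x ^ t := by
                rw [ENNReal.mul_rpow_of_nonneg _ _ ht0.le, ← ENNReal.rpow_mul,
                  ← ENNReal.rpow_mul, inv_mul_cancel₀ ht0.ne', ENNReal.rpow_one, sub_mul,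
                  inv_mul_cancel₀ ht0.ne', one_mul]
            _ ≤ _ := by
                exact mul_le_mul_left (ENNReal.rpow_le_rpow (hwS N) (by linarith)) _
      _ = S σ ^ (t - 1) * ∑ i ∈ Finset.range N, w i *
          (2 ^ (-((k₀ : ℝ) * n)) * G.avg k₀ (fun y => φ (k₀ - 1 - i) y ^ t) x₀) := by
          rw [lintegral_const_mul' _ _
            (ENNReal.rpow_ne_top_of_nonneg (by linarith) (hS σ hσ)),
            lintegral_finsetSum _ fun i _ => (hm i).const_mul _]
          simp_rw [← setLIntegral_cell]
          congr 1
          exact Finset.sum_congr rfl fun i _ => lintegral_const_mul' _ _ (hw_ne i)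
      _ ≤ S σ ^ (t - 1) * ∑ i ∈ Finset.range N, 2 ^ (-((k₀ : ℝ) * n)) *
          (K (t * R) ^ (1 / R) * 2 ^ (-(σ / 2 * i))) := by
          refine mul_le_mul_right (Finset.sum_le_sum fun i _ => ?_) _
          calc w i * (2 ^ (-((k₀ : ℝ) * n)) * G.avg k₀ (fun y => φ (k₀ - 1 - i) y ^ t) x₀)
              ≤ w i * (2 ^ (-((k₀ : ℝ) * n)) *
                (2 ^ (σ / 2 * ((i : ℝ) + 1)) * K (t * R) ^ (1 / R))) := by
                gcongr; exact hφt i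
            _ = 2 ^ (-((k₀ : ℝ) * n)) * (K (t * R) ^ (1 / R) *
                (w i * 2 ^ (σ / 2 * ((i : ℝ) + 1)))) := by ring
            _ ≤ _ := by
                gcongr
                rw [hw, ← two_rpow_add]
                exact two_rpow_mono (by nlinarith)
      _ ≤ _ := by
          rw [← Finset.mul_sum, ← Finset.mul_sum, mul_left_comm]
          gcongr
          exact ENNReal.sum_le_tsum _
  have hall := lintegral_tsum_rpow_le ht0 (μ := volume.restrict (G.cell k₀ x₀))
    (g := fun i x => w i * φ (k₀ - 1 - i) x) (fun i => (hφ _).const_mul _) hpart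
  have h2t : ((2 : ℝ≥0∞) ^ ((k₀ : ℝ) * σ)) ^ t = 2 ^ ((k₀ : ℝ) * σ * t) :=
    (ENNReal.rpow_mul _ _ _).symm
  calc G.avg k₀ (fun x => (∑' i : ℕ, G.fracTerm α u φ f (k₀ - 1 - i) x) ^ t) x₀
      ≤ G.avg k₀ (fun x => 2 ^ ((k₀ : ℝ) * σ * t) *
          (∑' i : ℕ, w i * φ (k₀ - 1 - i) x) ^ t) x₀ := by
        refine G.avg_mono _ _ fun x _ => ?_
        rw [← h2t, ← ENNReal.mul_rpow_of_nonneg _ _ ht0.le, ← ENNReal.tsum_mul_left]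
        gcongr with i
        exact hterm i x
    _ = 2 ^ ((k₀ : ℝ) * σ * t) * (2 ^ ((k₀ : ℝ) * n) *
          ∫⁻ x in G.cell k₀ x₀, (∑' i : ℕ, w i * φ (k₀ - 1 - i) x) ^ t) :=
        G.avg_const_mul _ (two_rpow_ne_top _) _ _
    _ ≤ 2 ^ ((k₀ : ℝ) * σ * t) * (2 ^ ((k₀ : ℝ) * n) * (2 ^ (-((k₀ : ℝ) * n)) *
          (S σ ^ (t - 1) * (K (t * R) ^ (1 / R) * S (σ / 2))))) := by gcongr
    _ = _ := by
        rw [← mul_assoc (2 ^ ((k₀ : ℝ) * n)), two_rpow_mul_neg, one_mul, mul_comm]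

end DyadicGrid

/-- The measure of a ball of radius `R`. -/
noncomputable def ballVolume (n : ℕ) (R : ℝ) : ℝ≥0∞ :=
  ENNReal.ofReal (R ^ n) * volume (ball (0 : Eucl n) 1)

theorem ballVolume_ne_top (n : ℕ) (R : ℝ) : ballVolume n R ≠ ⊤ :=
  ENNReal.mul_ne_top ENNReal.ofReal_ne_top measure_ball_lt_top.ne

theorem ballVolume_ne_zero (n : ℕ) {R : ℝ} (hR : 0 < R) : ballVolume n R ≠ 0 :=
  mul_ne_zero (by simpa using pow_pos hR n) (measure_ball_pos _ _ one_pos).ne'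

theorem volume_ball_mul_two_rpow {n : ℕ} (x : Eucl n) {R : ℝ} (hR : 0 < R) (k : ℝ) :
    volume (ball x (R * (2 : ℝ) ^ (-k))) = ballVolume n R * 2 ^ (-(k * n)) := by
  have h2 : (0 : ℝ) < 2 ^ (-k) := by positivity
  rw [Measure.addHaar_ball_of_pos _ _ (mul_pos hR h2), finrank_euclideanSpace_fin, ballVolume,
    mul_pow, ENNReal.ofReal_mul (by positivity), ← Real.rpow_natCast (2 ^ (-k)) n,
    ← Real.rpow_mul (by norm_num), ← ENNReal.ofReal_rpow_of_pos (by norm_num),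
    ENNReal.ofReal_ofNat]
  ring_nf

theorem rpow_le_tsum_mul_rpow {D : ℝ≥0∞} (hD0 : D ≠ 0) {r : ℝ} (hr : 0 < r)
    {e : ℝ≥0∞} (he : e ≠ ⊤) :
    e ^ r ≤ ∑' i : ℕ, (((i : ℝ≥0∞) + 1) * D) ^ r * (if (i : ℝ≥0∞) * D < e then 1 else 0) := by
  by_cases h0 : e = 0
  · simp [h0, hr]
  have hex : ∃ i : ℕ, e ≤ ((i : ℝ≥0∞) + 1) * D := by
    obtain ⟨m, hm⟩ := ENNReal.exists_nat_mul_gt hD0 he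
    exact ⟨m, hm.le.trans (by gcongr; exact le_self_add)⟩
  classical
  set i := Nat.find hex with hi
  have hle : e ≤ ((i : ℝ≥0∞) + 1) * D := Nat.find_spec hex
  have hlt : (i : ℝ≥0∞) * D < e := by
    rcases Nat.eq_zero_or_pos i with h | h
    · rw [h]; simpa using pos_iff_ne_zero.2 h0
    · have := Nat.find_min hex (m := i - 1) (by omega)
      rw [not_le] at this
      convert this using 2
      rw [← Nat.cast_add_one]
      congr 1; omega
  refine le_trans ?_ (ENNReal.le_tsum i)
  rw [if_pos hlt, mul_one]
  exact ENNReal.rpow_le_rpow hle hr.le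

theorem tsum_mul_rpow_mul_two_rpow_neg_ne_top {D : ℝ≥0∞} (hD : D ≠ ⊤) {r : ℝ} (hr : 0 ≤ r) :
    ∑' i : ℕ, (((i : ℝ≥0∞) + 1) * D) ^ r * 2 ^ (-(i : ℝ)) ≠ ⊤ := by
  obtain ⟨m, hm⟩ := exists_nat_ge r
  have hs : Summable fun i : ℕ => ((i : ℝ) ^ m * (1 / 2 : ℝ) ^ i) :=
    summable_pow_mul_geometric_of_norm_lt_one m (by norm_num)
  have hs' := ((summable_nat_add_iff 1).2 hs).tsum_ofReal_ne_top
  refine ne_top_of_le_ne_top (b := 2 * D ^ r * ∑' i : ℕ, ENNReal.ofReal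
    (((i + 1 : ℕ) : ℝ) ^ m * (1 / 2 : ℝ) ^ (i + 1))) (ENNReal.mul_ne_top (ENNReal.mul_ne_top
      (by simp) (ENNReal.rpow_ne_top_of_nonneg hr hD)) hs') ?_
  rw [← ENNReal.tsum_mul_left]
  refine ENNReal.tsum_le_tsum fun i => ?_
  have h1 : ((i : ℝ≥0∞) + 1) ^ r ≤ ((i : ℝ≥0∞) + 1) ^ m := by
    rw [← ENNReal.rpow_natCast]
    exact ENNReal.rpow_le_rpow_of_exponent_le le_add_self hm
  have h2 : ENNReal.ofReal (((i + 1 : ℕ) : ℝ) ^ m * (1 / 2 : ℝ) ^ (i + 1)) =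
      ((i : ℝ≥0∞) + 1) ^ m * 2 ^ (-((i : ℝ) + 1)) := by
    rw [ENNReal.ofReal_mul (by positivity), ENNReal.ofReal_pow (by positivity),
      ENNReal.ofReal_natCast, ← Real.rpow_natCast (1 / 2), one_div, Real.inv_rpow (by norm_num),
      ← Real.rpow_neg (by norm_num), ← ENNReal.ofReal_rpow_of_pos (by norm_num),
      ENNReal.ofReal_ofNat]
    push_cast
    rfl
  rw [h2, ENNReal.mul_rpow_of_nonneg _ _ hr]
  calc ((i : ℝ≥0∞) + 1) ^ r * D ^ r * 2 ^ (-(i : ℝ))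
      ≤ ((i : ℝ≥0∞) + 1) ^ m * D ^ r * (2 ^ (1 : ℝ) * 2 ^ (-((i : ℝ) + 1))) := by
        rw [← two_rpow_add, show (1 : ℝ) + -((i : ℝ) + 1) = -i by ring]
        gcongr
    _ = _ := by rw [ENNReal.rpow_one]; ring

namespace DyadicGrid

variable {n : ℕ} (G : DyadicGrid n)

theorem cell_subset_ball (k : ℤ) (x : Eucl n) :
    G.cell k x ⊆ ball x (((n : ℝ) + 1) * (2 : ℝ) ^ (-(k : ℝ))) := fun y hy => by
  have h2 : (0 : ℝ) < 2 ^ (-(k : ℝ)) := by positivity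
  have := G.dist_le k y x hy
  rw [mem_ball]
  nlinarith

/-- The mean of `b` over the cell of level `k` containing `x`. -/
noncomputable def mean (b : Eucl n → ℝ) (k : ℤ) (x : Eucl n) : ℝ := ⨍ y in G.cell k x, b y

theorem cellConst_mean (b : Eucl n → ℝ) (k : ℤ) : G.CellConst k (G.mean b k) :=
  fun x y h => by simp only [mean, G.cell_congr h]

theorem measurable_mean (b : Eucl n → ℝ) (k : ℤ) : Measurable (G.mean b k) :=
  (G.cellConst_mean b k).measurable

theorem integrableOn_cell {b : Eucl n → ℝ} (hb : LocallyIntegrable b) (k : ℤ) (x : Eucl n) :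
    IntegrableOn b (G.cell k x) :=
  (hb.integrableOn_isCompact (isCompact_closedBall x _)).mono_set
    ((G.cell_subset_ball k x).trans ball_subset_closedBall)

theorem edist_mean_le {b : Eucl n → ℝ} (hb : LocallyIntegrable b) (k : ℤ) (x : Eucl n) (d : ℝ) :
    edist (G.mean b k x) d ≤ G.avg k (fun y => edist (b y) d) x := by
  set V := volume (G.cell k x) with hV
  have hV' : V = 2 ^ (-((k : ℝ) * n)) := G.volume_cell k x
  have hV0 : V ≠ 0 := hV' ▸ two_rpow_ne_zero _
  have hVt : V ≠ ⊤ := hV' ▸ two_rpow_ne_top _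
  have hVi : V⁻¹ = 2 ^ ((k : ℝ) * n) := by rw [hV', ENNReal.rpow_neg, inv_inv]
  have hmean : G.mean b k x = ∫ y, b y ∂(V⁻¹ • volume.restrict (G.cell k x)) := by
    rw [mean, average, Measure.restrict_apply_univ]
  have : IsProbabilityMeasure (V⁻¹ • volume.restrict (G.cell k x)) :=
    ⟨by simp [← hV, ENNReal.inv_mul_cancel hV0 hVt]⟩
  have hint : Integrable b (V⁻¹ • volume.restrict (G.cell k x)) :=
    (G.integrableOn_cell hb k x).smul_measure (ENNReal.inv_ne_top.2 hV0)
  have hsub : G.mean b k x - d = ∫ y, (b y - d) ∂(V⁻¹ • volume.restrict (G.cell k x)) := by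
    rw [integral_sub hint (integrable_const d), hmean]
    simp
  rw [edist_eq_enorm_sub, hsub]
  refine (enorm_integral_le_lintegral_enorm _).trans (le_of_eq ?_)
  rw [lintegral_smul_measure, avg, hVi]
  simp_rw [edist_eq_enorm_sub, smul_eq_mul]

/-- A bound for the mean oscillation on cells of a function with BMO norm at most one. -/
noncomputable def oscBound (n : ℕ) : ℝ≥0∞ := 2 * ballVolume n ((n : ℝ) + 1)

theorem oscBound_ne_top (n : ℕ) : oscBound n ≠ ⊤ :=
  ENNReal.mul_ne_top (by simp) (ballVolume_ne_top _ _)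

theorem oscBound_ne_zero (n : ℕ) : oscBound n ≠ 0 :=
  mul_ne_zero (by simp) (ballVolume_ne_zero _ (by positivity))

theorem avg_edist_mean_le {b : Eucl n → ℝ} (hb : LocallyIntegrable b) (hb1 : bmoNorm n b ≤ 1)
    (k : ℤ) (x : Eucl n) :
    G.avg k (fun y => edist (b y) (G.mean b k x)) x ≤ oscBound n := by
  set R : ℝ := ((n : ℝ) + 1) * (2 : ℝ) ^ (-(k : ℝ)) with hR
  have hR0 : 0 < R := by positivity
  set m := ballAvg n b x R with hm
  have h1 : G.avg k (fun y => edist (b y) m) x ≤ ballVolume n ((n : ℝ) + 1) := by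
    have h2 : (volume (ball x R))⁻¹ * ∫⁻ y in ball x R, ENNReal.ofReal |b y - m| ≤ 1 :=
      (le_iSup₂_of_le x R (le_iSup_of_le (i := hR0) (by rfl))).trans hb1
    rw [mul_comm, ← div_eq_mul_inv, ENNReal.div_le_iff (measure_ball_pos _ _ hR0).ne'
      measure_ball_lt_top.ne, one_mul, hR, volume_ball_mul_two_rpow _ (by positivity)] at h2
    simp only [avg]
    calc 2 ^ ((k : ℝ) * n) * ∫⁻ y in G.cell k x, edist (b y) m
        ≤ 2 ^ ((k : ℝ) * n) * ∫⁻ y in ball x R, edist (b y) m := by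
          gcongr
          exact G.cell_subset_ball k x
      _ = 2 ^ ((k : ℝ) * n) * ∫⁻ y in ball x R, ENNReal.ofReal |b y - m| := by
          simp_rw [edist_dist, Real.dist_eq]
      _ ≤ 2 ^ ((k : ℝ) * n) * (ballVolume n ((n : ℝ) + 1) * 2 ^ (-((k : ℝ) * n))) := by
          gcongr
      _ = _ := by rw [mul_left_comm, two_rpow_mul_neg, mul_one]
  calc G.avg k (fun y => edist (b y) (G.mean b k x)) x
      ≤ G.avg k (fun y => edist (G.mean b k x) m + edist (b y) m) x :=
        G.avg_mono _ _ fun y _ => by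
          rw [add_comm]
          exact edist_triangle_right _ _ _
    _ = edist (G.mean b k x) m + G.avg k (fun y => edist (b y) m) x := by
        rw [G.avg_add _ measurable_const, avg_const]
    _ ≤ ballVolume n ((n : ℝ) + 1) + ballVolume n ((n : ℝ) + 1) :=
        add_le_add ((G.edist_mean_le hb k x m).trans h1) h1
    _ = oscBound n := (two_mul _).symm

theorem edist_mean_succ_le {b : Eucl n → ℝ} (hb : LocallyIntegrable b) (hb1 : bmoNorm n b ≤ 1)
    (k : ℤ) (x : Eucl n) :
    edist (G.mean b (k + 1) x) (G.mean b k x) ≤ 2 ^ (n : ℝ) * oscBound n :=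
  (G.edist_mean_le hb (k + 1) x _).trans ((G.avg_le_of_succ k _ x).trans
    (mul_le_mul_right (G.avg_edist_mean_le hb hb1 k x) _))

/-- The step of the levels in the John–Nirenberg inequality. -/
noncomputable def jnStep (n : ℕ) : ℝ≥0∞ := 2 * oscBound n + 2 ^ (n : ℝ) * oscBound n

theorem jnStep_ne_top (n : ℕ) : jnStep n ≠ ⊤ :=
  ENNReal.add_ne_top.2 ⟨ENNReal.mul_ne_top (by simp) (oscBound_ne_top n),
    ENNReal.mul_ne_top (two_rpow_ne_top _) (oscBound_ne_top n)⟩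

theorem jnStep_ne_zero (n : ℕ) : jnStep n ≠ 0 := by
  simp [jnStep, oscBound_ne_zero]

/-- The points where the means over the cells of level at least `k` deviate by more than
`i` steps from the mean over the cell of level `k`. -/
def jnSet (b : Eucl n → ℝ) (i : ℕ) (k : ℤ) : Set (Eucl n) :=
  {y | ∃ j : ℕ, (i : ℝ≥0∞) * jnStep n < edist (G.mean b (k + j) y) (G.mean b k y)}

theorem measurableSet_jnSet (b : Eucl n → ℝ) (i : ℕ) (k : ℤ) :
    MeasurableSet (G.jnSet b i k) := by
  simp only [jnSet, Set.ofPred_exists]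
  exact MeasurableSet.iUnion fun j => measurableSet_lt measurable_const
    ((G.measurable_mean b _).edist (G.measurable_mean b _))

/-- The John–Nirenberg inequality. -/
theorem avg_indicator_jnSet_le {b : Eucl n → ℝ} (hb : LocallyIntegrable b) (hb1 : bmoNorm n b ≤ 1)
    (hbm : Measurable b) (i : ℕ) (k : ℤ) (x : Eucl n) :
    G.avg k ((G.jnSet b i k).indicator 1) x ≤ 2 ^ (-(i : ℝ)) := by
  induction i generalizing k x with
  | zero =>
    refine (G.avg_mono k (h := fun _ => 1) x fun y _ => ?_).trans (by simp [avg_const])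
    exact Set.indicator_le_self _ _ _
  | succ i ih =>
    set B := oscBound n with hB
    have hB0 : B ≠ 0 := oscBound_ne_zero n
    have hBt : B ≠ ⊤ := oscBound_ne_top n
    set Q := G.cell k x with hQ
    have hQm : MeasurableSet Q := G.measurableSet_cell k x
    set m := G.mean b k x with hm
    have hmQ : ∀ y ∈ Q, G.mean b k y = m := fun y hy => G.cellConst_mean b k y x hy
    set A : ℕ → Set (Eucl n) := fun j => {y | y ∈ Q ∧ 2 * B < edist (G.mean b (k + j) y) m}
    have hA : ∀ j : ℕ, G.CellUnion (k + j) (A j) := fun j y z hyz => by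
      have h1 : y ∈ Q ↔ z ∈ Q := by
        rw [hQ, mem_cell, mem_cell, G.idx_congr_of_le (show k ≤ k + j by omega) hyz]
      simp only [A, Set.mem_ofPred_eq, h1, G.cellConst_mean b _ y z hyz]
    have hD := cellUnion_disjointed hA
    have hJm : ∀ k' : ℤ, MeasurableSet (G.jnSet b i k') := fun k' => G.measurableSet_jnSet b i k'
    -- stopping-time decomposition
    have hsub : Q ∩ G.jnSet b (i + 1) k ⊆
        ⋃ j : ℕ, disjointed A j ∩ G.jnSet b i (k + j) := by
      rintro y ⟨hyQ, j, hj⟩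
      rw [hmQ y hyQ] at hj
      have hDj : jnStep n ≤ ((i + 1 : ℕ) : ℝ≥0∞) * jnStep n := by
        conv_lhs => rw [← one_mul (jnStep n)]
        gcongr
        simp
      have hyA : y ∈ ⋃ j, disjointed A j := by
        rw [iUnion_disjointed]
        exact Set.mem_iUnion.2 ⟨j, hyQ, (le_self_add.trans hDj).trans_lt hj⟩
      obtain ⟨j₁, hj₁⟩ := Set.mem_iUnion.1 hyA
      refine Set.mem_iUnion.2 ⟨j₁, hj₁, ?_⟩
      have hnot : ∀ j' < j₁, ¬ 2 * B < edist (G.mean b (k + j') y) m := fun j' hj' h => by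
        rw [disjointed_apply] at hj₁
        refine hj₁.2 ?_
        simp only [Finset.sup_set_eq_biUnion, Set.mem_iUnion]
        exact ⟨j', by simpa using hj', hyQ, h⟩
      have hjj : j₁ ≤ j := by
        by_contra hlt
        exact hnot j (not_le.1 hlt) ((le_self_add.trans hDj).trans_lt hj)
      have hstep : edist (G.mean b (k + j₁) y) m ≤ jnStep n := by
        rcases j₁ with _ | j₂
        · have : G.mean b (k + (0 : ℕ)) y = m := by simpa using hmQ y hyQ
          rw [this, edist_self]
          exact bot_le
        · have h1 := G.edist_mean_succ_le hb hb1 (k + j₂) y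
          have h2 := not_lt.1 (hnot j₂ (Nat.lt_succ_self _))
          rw [show k + ((j₂ + 1 : ℕ) : ℤ) = k + j₂ + 1 by push_cast; ring]
          calc _ ≤ _ := edist_triangle _ (G.mean b (k + j₂) y) _
            _ ≤ _ := add_le_add h1 h2
            _ = jnStep n := by rw [jnStep, add_comm]
      refine ⟨j - j₁, ?_⟩
      rw [show k + (j₁ : ℤ) + ((j - j₁ : ℕ) : ℤ) = k + j by omega]
      by_contra hle
      refine hj.not_ge ((edist_triangle _ (G.mean b (k + j₁) y) _).trans ?_)
      refine (add_le_add (not_lt.1 hle) hstep).trans (le_of_eq ?_)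
      push_cast
      ring
    have hvolD : ∀ j : ℕ, volume (disjointed A j ∩ G.jnSet b i (k + j)) ≤
        2 ^ (-(i : ℝ)) * volume (disjointed A j) := fun j => by
      calc volume (disjointed A j ∩ G.jnSet b i (k + j))
          = ∫⁻ y in disjointed A j, (G.jnSet b i (k + j)).indicator 1 y := by
            rw [lintegral_indicator_one (hJm _), Measure.restrict_apply (hJm _), Set.inter_comm]
        _ = ∫⁻ y in disjointed A j, G.avg (k + j) ((G.jnSet b i (k + j)).indicator 1) y :=
            ((hD j).setLIntegral_avg (measurable_one.indicator (hJm _))).symm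
        _ ≤ ∫⁻ y in disjointed A j, 2 ^ (-(i : ℝ)) := by
            gcongr with y
            exact ih _ _
        _ = _ := by rw [setLIntegral_const]
    have hvolA : 2 * volume (⋃ j, A j) ≤ 2 ^ (-((k : ℝ) * n)) := by
      set g : Eucl n → ℝ≥0∞ := Q.indicator fun y => edist (b y) m with hg
      have hgm : Measurable g := (hbm.edist measurable_const).indicator hQm
      have h1 : (⋃ j, A j) ⊆ {y | 2 * B < G.maxFn k g y} := by
        refine Set.iUnion_subset fun j y hy => hy.2.trans_le ?_
        refine le_trans ?_ (G.avg_le_maxFn k j g y)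
        refine (G.edist_mean_le hb (k + j) y m).trans (G.avg_mono _ _ fun z hz => ?_)
        have hzQ : z ∈ Q := by
          rw [hQ, ← G.cell_congr hy.1]
          exact G.cell_subset_of_le (show k ≤ k + j by omega) y hz
        rw [hg, Set.indicator_of_mem hzQ]
      have h2 := G.mul_volume_lt_maxFn_le k hgm (2 * B)
      have h3 : ∫⁻ y, g y ≤ 2 ^ (-((k : ℝ) * n)) * B := by
        rw [hg, lintegral_indicator hQm, setLIntegral_cell]
        exact mul_le_mul_right (G.avg_edist_mean_le hb hb1 k x) _
      rw [← ENNReal.mul_le_mul_iff_left hB0 hBt, mul_right_comm]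
      exact (mul_le_mul_right (measure_mono h1) _).trans (h2.trans h3)
    have hvol : volume (Q ∩ G.jnSet b (i + 1) k) ≤
        2 ^ (-(i : ℝ)) * volume (⋃ j, A j) := by
      calc volume (Q ∩ G.jnSet b (i + 1) k)
          ≤ ∑' j, volume (disjointed A j ∩ G.jnSet b i (k + j)) :=
            (measure_mono hsub).trans (measure_iUnion_le _)
        _ ≤ ∑' j, 2 ^ (-(i : ℝ)) * volume (disjointed A j) := ENNReal.tsum_le_tsum hvolD
        _ = 2 ^ (-(i : ℝ)) * volume (⋃ j, A j) := by
            rw [ENNReal.tsum_mul_left, ← iUnion_disjointed,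
              measure_iUnion (disjoint_disjointed A) fun j => (hD j).measurableSet]
    calc G.avg k ((G.jnSet b (i + 1) k).indicator 1) x
        = 2 ^ ((k : ℝ) * n) * volume (Q ∩ G.jnSet b (i + 1) k) := by
          rw [avg, lintegral_indicator_one (G.measurableSet_jnSet _ _ _),
            Measure.restrict_apply (G.measurableSet_jnSet _ _ _), Set.inter_comm]
      _ ≤ 2 ^ ((k : ℝ) * n) * (2 ^ (-(i : ℝ)) * (2 ^ (-1 : ℝ) * 2 ^ (-((k : ℝ) * n)))) := by
          gcongr
          refine hvol.trans ?_
          gcongr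
          calc volume (⋃ j, A j) = 2 ^ (-1 : ℝ) * (2 * volume (⋃ j, A j)) := by
                rw [← mul_assoc, ENNReal.rpow_neg_one, ENNReal.inv_mul_cancel (by simp) (by simp),
                  one_mul]
            _ ≤ _ := by gcongr
      _ = 2 ^ (-(i : ℝ)) * 2 ^ (-1 : ℝ) * (2 ^ ((k : ℝ) * n) * 2 ^ (-((k : ℝ) * n))) := by ring
      _ = 2 ^ (-((i + 1 : ℕ) : ℝ)) := by
          rw [two_rpow_mul_neg, mul_one, ← two_rpow_add]
          push_cast
          ring_nf

theorem ae_tendsto_mean {b : Eucl n → ℝ} (hb : LocallyIntegrable b)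
    (k : ℤ) :
    ∀ᵐ x, Filter.Tendsto (fun j : ℕ => G.mean b (k + j) x) Filter.atTop (nhds (b x)) := by
  filter_upwards [(IsUnifLocDoublingMeasure.vitaliFamily volume 1).ae_tendsto_lintegral_enorm_sub_div
    hb] with x hx
  set δ : ℕ → ℝ := fun j => ((n : ℝ) + 1) * (2 : ℝ) ^ (-((k + j : ℤ) : ℝ)) with hδ
  have hδ0 : ∀ j, 0 < δ j := fun j => by positivity
  have hδlim : Filter.Tendsto δ Filter.atTop (nhdsWithin 0 (Set.Ioi 0)) := by
    refine tendsto_nhdsWithin_iff.2 ⟨?_, Filter.Eventually.of_forall hδ0⟩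
    have h1 : ∀ j, δ j = (((n : ℝ) + 1) * 2 ^ (-(k : ℝ))) * (1 / 2 : ℝ) ^ j := fun j => by
      rw [hδ, one_div, inv_pow, ← Real.rpow_natCast 2 j, ← Real.rpow_neg (by norm_num), mul_assoc,
        ← Real.rpow_add (by norm_num)]
      push_cast
      ring_nf
    rw [funext h1]
    simpa using (tendsto_pow_atTop_nhds_zero_of_lt_one (r := (1 / 2 : ℝ)) (by norm_num)
      (by norm_num)).const_mul (((n : ℝ) + 1) * 2 ^ (-(k : ℝ)))
  have h2 := hx.comp (IsUnifLocDoublingMeasure.tendsto_closedBall_filterAt volume (K := 1)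
    (fun _ : ℕ => x) δ hδlim (Filter.Eventually.of_forall fun j =>
      mem_closedBall_self (by rw [one_mul]; exact (hδ0 j).le)))
  have h3 := ENNReal.Tendsto.const_mul (a := ballVolume n ((n : ℝ) + 1)) h2
    (Or.inr (ballVolume_ne_top n _))
  rw [mul_zero] at h3
  rw [tendsto_iff_edist_tendsto_0]
  refine tendsto_of_tendsto_of_tendsto_of_le_of_le tendsto_const_nhds h3 (fun _ => bot_le)
    fun j => ?_
  have hvol : volume (closedBall x (δ j)) =
      ballVolume n ((n : ℝ) + 1) * 2 ^ (-(((k + j : ℤ) : ℝ) * n)) := by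
    rw [Measure.addHaar_closedBall _ _ (hδ0 j).le, ← Measure.addHaar_ball_of_pos _ x (hδ0 j), hδ,
      volume_ball_mul_two_rpow _ (by positivity)]
  have hV0 := ballVolume_ne_zero n (show 0 < (n : ℝ) + 1 by positivity)
  have hVt := ballVolume_ne_top n ((n : ℝ) + 1)
  refine (G.edist_mean_le hb (k + j) x (b x)).trans ?_
  simp only [Function.comp, hvol, avg]
  rw [ENNReal.div_eq_inv_mul, ENNReal.mul_inv (Or.inl hV0) (Or.inl hVt), ← mul_assoc, ← mul_assoc,
    ENNReal.mul_inv_cancel hV0 hVt, one_mul, ENNReal.rpow_neg, inv_inv]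
  gcongr
  · exact (G.cell_subset_ball _ _).trans ball_subset_closedBall
  · rw [edist_eq_enorm_sub]

/-- A bound for the moments of the deviations from the means. -/
noncomputable def jnMoment (n : ℕ) (r : ℝ) : ℝ≥0∞ :=
  ∑' i : ℕ, (((i : ℝ≥0∞) + 1) * jnStep n) ^ r * 2 ^ (-(i : ℝ))

theorem avg_edist_mean_rpow_le {b : Eucl n → ℝ} (hb : LocallyIntegrable b) (hb1 : bmoNorm n b ≤ 1)
    (hbm : Measurable b) {r : ℝ} (hr : 0 < r) (k : ℤ) (x : Eucl n) :
    G.avg k (fun y => edist (b y) (G.mean b k y) ^ r) x ≤ jnMoment n r := by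
  have hae : ∀ᵐ y, edist (b y) (G.mean b k y) ^ r ≤
      ∑' i : ℕ, (((i : ℝ≥0∞) + 1) * jnStep n) ^ r * (G.jnSet b i k).indicator 1 y := by
    filter_upwards [G.ae_tendsto_mean hb k] with y hy
    refine (rpow_le_tsum_mul_rpow (jnStep_ne_zero n) hr (edist_ne_top _ _)).trans ?_
    refine ENNReal.tsum_le_tsum fun i => mul_le_mul_right ?_ _
    split_ifs with h
    · have hy' : y ∈ G.jnSet b i k :=
        ((hy.edist (tendsto_const_nhds (x := G.mean b k y))).eventually_const_lt h).exists
      rw [Set.indicator_of_mem hy']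
      rfl
    · exact bot_le
  have hne : ∀ i : ℕ, (((i : ℝ≥0∞) + 1) * jnStep n) ^ r ≠ ⊤ := fun i =>
    ENNReal.rpow_ne_top_of_nonneg hr.le (ENNReal.mul_ne_top (by simp) (jnStep_ne_top n))
  have hm : ∀ i : ℕ, Measurable ((G.jnSet b i k).indicator (1 : Eucl n → ℝ≥0∞)) := fun i =>
    measurable_one.indicator (G.measurableSet_jnSet b i k)
  calc G.avg k (fun y => edist (b y) (G.mean b k y) ^ r) x
      ≤ G.avg k (fun y => ∑' i : ℕ, (((i : ℝ≥0∞) + 1) * jnStep n) ^ r *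
          (G.jnSet b i k).indicator 1 y) x :=
        mul_le_mul_right (lintegral_mono_ae (ae_restrict_of_ae hae)) _
    _ = ∑' i : ℕ, (((i : ℝ≥0∞) + 1) * jnStep n) ^ r *
          G.avg k ((G.jnSet b i k).indicator 1) x := by
        simp only [avg]
        rw [lintegral_tsum fun i => ((hm i).const_mul _).aemeasurable, ← ENNReal.tsum_mul_left]
        refine tsum_congr fun i => ?_
        rw [lintegral_const_mul' _ _ (hne i), mul_left_comm]
    _ ≤ jnMoment n r := ENNReal.tsum_le_tsum fun i =>
        mul_le_mul_right (G.avg_indicator_jnSet_le hb hb1 hbm i k x) _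

/-- The size of `b` relative to its means, in a form suited to products of `l` factors. -/
noncomputable def deviation (b : Eucl n → ℝ) (l : ℕ) (k : ℤ) (x : Eucl n) : ℝ≥0∞ :=
  1 + edist (b x) (G.mean b k x) ^ l

/-- A bound for the moments of `DyadicGrid.deviation`. -/
noncomputable def deviationBound (n l : ℕ) (r : ℝ) : ℝ≥0∞ :=
  2 ^ (r - 1) * (1 + jnMoment n (l * max r 1))

theorem deviationBound_ne_top (n l : ℕ) (r : ℝ) : deviationBound n l r ≠ ⊤ := by
  refine ENNReal.mul_ne_top (two_rpow_ne_top _) (ENNReal.add_ne_top.2 ⟨by simp, ?_⟩)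
  exact tsum_mul_rpow_mul_two_rpow_neg_ne_top (jnStep_ne_top n) (by positivity)

theorem measurable_deviation {b : Eucl n → ℝ} (hbm : Measurable b)
    (l : ℕ) (k : ℤ) : Measurable (G.deviation b l k) :=
  ((hbm.edist (G.measurable_mean b k)).pow_const l).const_add 1

theorem avg_deviation_rpow_le {b : Eucl n → ℝ} (hb : LocallyIntegrable b) (hb1 : bmoNorm n b ≤ 1)
    (hbm : Measurable b) {l : ℕ} (hl : 0 < l) {r : ℝ} (hr : 1 ≤ r) (k : ℤ) (x : Eucl n) :
    G.avg k (fun y => G.deviation b l k y ^ r) x ≤ deviationBound n l r := by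
  have hl' : (0 : ℝ) < l := by exact_mod_cast hl
  calc G.avg k (fun y => G.deviation b l k y ^ r) x
      ≤ G.avg k (fun y => 2 ^ (r - 1) * (1 + edist (b y) (G.mean b k y) ^ (l * r))) x :=
        G.avg_mono _ _ fun y _ => by
          refine (ENNReal.rpow_add_le_mul_rpow_add_rpow _ _ hr).trans (le_of_eq ?_)
          rw [ENNReal.one_rpow, ← ENNReal.rpow_natCast, ← ENNReal.rpow_mul]
    _ = 2 ^ (r - 1) * (1 + G.avg k (fun y => edist (b y) (G.mean b k y) ^ (l * r)) x) := by
        rw [G.avg_const_mul _ (two_rpow_ne_top _), G.avg_add _ measurable_const, avg_const]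
    _ ≤ deviationBound n l r := by
        rw [deviationBound, max_eq_left hr]
        gcongr
        exact G.avg_edist_mean_rpow_le hb hb1 hbm (by nlinarith) k x

end DyadicGrid

/-- The sign `(-1)^k` as a real number. -/
noncomputable def altSign (k : ℤ) : ℝ := ((k.negOnePow : ℤ) : ℝ)

theorem altSign_succ (k : ℤ) : altSign (k + 1) = -altSign k := by
  simp [altSign, Int.negOnePow_succ]

theorem altSign_eq_one_or (k : ℤ) : altSign k = 1 ∨ altSign k = -1 := by
  rcases Int.units_eq_one_or k.negOnePow with h | h <;> simp [altSign, h]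

/-- The index of the dyadic interval of level `k` containing `x`, for the grid shifted by
`(-1)^k ω / 3`. -/
noncomputable def shiftedFloor (ω : Fin 2) (k : ℤ) (x : ℝ) : ℤ :=
  ⌊(2 : ℝ) ^ (k : ℝ) * x + altSign k * (ω : ℕ) / 3⌋

theorem shiftedFloor_eq_div (ω : Fin 2) (k : ℤ) (x : ℝ) :
    shiftedFloor ω k x = (shiftedFloor ω (k + 1) x + (k.negOnePow : ℤ) * (ω : ℕ)) / 2 := by
  have h : (2 : ℝ) ^ (k : ℝ) * x + altSign k * (ω : ℕ) / 3 =
      ((2 : ℝ) ^ ((k + 1 : ℤ) : ℝ) * x + altSign (k + 1) * (ω : ℕ) / 3 +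
        (((k.negOnePow : ℤ) * (ω : ℕ) : ℤ) : ℝ)) / (2 : ℕ) := by
    rw [altSign_succ]
    push_cast
    rw [Real.rpow_add (by norm_num), Real.rpow_one, ← altSign]
    ring
  rw [shiftedFloor, h, Int.floor_div_natCast, Int.floor_add_intCast]
  rfl

theorem measurable_shiftedFloor (ω : Fin 2) (k : ℤ) : Measurable (shiftedFloor ω k) :=
  Int.measurable_floor.comp ((measurable_id.const_mul _).add_const _)

theorem setOf_shiftedFloor_eq (ω : Fin 2) (k m : ℤ) :
    {x | shiftedFloor ω k x = m} = Set.Ico ((m - altSign k * (ω : ℕ) / 3) * 2 ^ (-(k : ℝ)))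
      ((m + 1 - altSign k * (ω : ℕ) / 3) * 2 ^ (-(k : ℝ))) := by
  ext x
  have h2 : (0 : ℝ) < 2 ^ (k : ℝ) := by positivity
  rw [Set.mem_ofPred_eq, shiftedFloor, Int.floor_eq_iff, Set.mem_Ico, Real.rpow_neg (by norm_num),
    ← div_eq_mul_inv, ← div_eq_mul_inv, div_le_iff₀ h2, lt_div_iff₀ h2]
  constructor <;> rintro ⟨h₁, h₂⟩ <;> constructor <;> linarith

theorem abs_sub_le_of_shiftedFloor_eq {ω : Fin 2} {k : ℤ} {x y : ℝ}
    (h : shiftedFloor ω k x = shiftedFloor ω k y) : |x - y| ≤ 2 ^ (-(k : ℝ)) := by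
  have hx : x ∈ {x | shiftedFloor ω k x = shiftedFloor ω k y} := h
  have hy : y ∈ {x | shiftedFloor ω k x = shiftedFloor ω k y} := rfl
  rw [setOf_shiftedFloor_eq] at hx hy
  rw [abs_le]
  constructor <;> nlinarith [hx.1, hx.2, hy.1, hy.2]

theorem exists_shiftedFloor_eq {k : ℤ} {x y : ℝ} (h : 2 ^ (k : ℝ) * |x - y| < 1 / 3) :
    ∃ ω, shiftedFloor ω k x = shiftedFloor ω k y := by
  wlog hxy : x ≤ y generalizing x y
  · obtain ⟨ω, hω⟩ := this (by rwa [abs_sub_comm]) (le_of_not_ge hxy)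
    exact ⟨ω, hω.symm⟩
  have h2 : (0 : ℝ) < 2 ^ (k : ℝ) := by positivity
  rw [abs_sub_comm, abs_of_nonneg (sub_nonneg.2 hxy), mul_sub] at h
  have hle : (2 : ℝ) ^ (k : ℝ) * x ≤ 2 ^ (k : ℝ) * y := by gcongr
  by_cases h0 : shiftedFloor 0 k x = shiftedFloor 0 k y
  · exact ⟨0, h0⟩
  refine ⟨1, ?_⟩
  simp only [shiftedFloor, Fin.val_zero, Nat.cast_zero, mul_zero, zero_div, add_zero] at h0
  set a := (2 : ℝ) ^ (k : ℝ) * x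
  set b := (2 : ℝ) ^ (k : ℝ) * y
  have hlt : ⌊a⌋ + 1 ≤ ⌊b⌋ := (Int.floor_mono hle).lt_of_ne h0
  have hlt' : (⌊a⌋ : ℝ) + 1 ≤ ⌊b⌋ := by exact_mod_cast hlt
  have ha := Int.lt_floor_add_one a
  have hb := Int.floor_le b
  have ha' : a < ⌊b⌋ := by linarith
  simp only [shiftedFloor, Fin.val_one, Nat.cast_one, mul_one]
  rcases altSign_eq_one_or k with hs | hs
  · rw [hs]
    exact (Int.floor_eq_iff.2 ⟨by linarith, by linarith⟩ : ⌊a + 1 / 3⌋ = ⌊b⌋).trans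
      (Int.floor_eq_iff.2 ⟨by linarith, by linarith [Int.lt_floor_add_one b]⟩).symm
  · have e : ((⌊b⌋ - 1 : ℤ) : ℝ) = ⌊b⌋ - 1 := by push_cast; ring
    rw [hs]
    exact (Int.floor_eq_iff.2 ⟨by rw [e]; linarith, by rw [e]; linarith⟩ :
      ⌊a + -1 / 3⌋ = ⌊b⌋ - 1).trans
      (Int.floor_eq_iff.2 ⟨by rw [e]; linarith, by rw [e]; linarith⟩).symm

/-- The dyadic grid shifted by one third in the directions selected by `ω`. -/
noncomputable def shiftedGrid {n : ℕ} (ω : Fin n → Fin 2) : DyadicGrid n where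
  idx k x i := shiftedFloor (ω i) k (x i)
  measurable_idx k := measurable_pi_iff.2 fun i =>
    (measurable_shiftedFloor _ _).comp (by fun_prop)
  nested k x y h := by
    funext i
    have := congrFun h i
    simp only at this ⊢
    rw [shiftedFloor_eq_div, this, ← shiftedFloor_eq_div]
  volume_fiber k x := by
    set m : Fin n → ℤ := fun i => shiftedFloor (ω i) k (x i)
    have h : {y : Eucl n | (fun i => shiftedFloor (ω i) k (y i)) = m} =
        (@WithLp.ofLp 2 (Fin n → ℝ)) ⁻¹' (Set.univ.pi fun i =>
          {z | shiftedFloor (ω i) k z = m i}) := by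
      ext y
      simp [funext_iff, Set.mem_pi]
    have hm : ∀ i, MeasurableSet {z | shiftedFloor (ω i) k z = m i} := fun i =>
      measurable_shiftedFloor _ _ (measurableSet_singleton _)
    rw [h, (PiLp.volume_preserving_ofLp (Fin n)).measure_preimage
      (MeasurableSet.univ_pi hm).nullMeasurableSet, volume_pi_pi]
    have h1 : ∀ i, volume {z | shiftedFloor (ω i) k z = m i} = (2 : ℝ≥0∞) ^ (-(k : ℝ)) := fun i => by
      rw [setOf_shiftedFloor_eq, Real.volume_Ico, ← sub_mul, ← ENNReal.ofReal_ofNat 2,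
        ENNReal.ofReal_rpow_of_pos (by norm_num)]
      ring_nf
    simp_rw [h1]
    rw [Finset.prod_const, Finset.card_univ, Fintype.card_fin, ← ENNReal.rpow_natCast,
      ← ENNReal.rpow_mul]
    ring_nf
  dist_le k x y h := by
    have h1 : ∀ i, |x i - y i| ≤ 2 ^ (-(k : ℝ)) := fun i =>
      abs_sub_le_of_shiftedFloor_eq (congrFun h i)
    have hc : (0 : ℝ) ≤ 2 ^ (-(k : ℝ)) := by positivity
    rw [EuclideanSpace.dist_eq]
    refine Real.sqrt_le_iff.2 ⟨by positivity, ?_⟩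
    calc ∑ i, dist (x i) (y i) ^ 2 ≤ ∑ _i : Fin n, ((2 : ℝ) ^ (-(k : ℝ))) ^ 2 := by
          gcongr with i
          exact h1 i
      _ = n * ((2 : ℝ) ^ (-(k : ℝ))) ^ 2 := by simp
      _ ≤ ((n : ℝ) ^ 2) * ((2 : ℝ) ^ (-(k : ℝ))) ^ 2 := by
          gcongr
          exact_mod_cast Nat.le_self_pow two_ne_zero n
      _ = _ := by ring

theorem exists_shiftedGrid_idx_eq {n : ℕ} {k : ℤ} {x y : Eucl n}
    (h : 2 ^ (k : ℝ) * dist x y < 1 / 3) :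
    ∃ ω, (shiftedGrid ω).idx k y = (shiftedGrid ω).idx k x := by
  have h1 : ∀ i, ∃ ω, shiftedFloor ω k (y i) = shiftedFloor ω k (x i) := fun i => by
    refine exists_shiftedFloor_eq (lt_of_le_of_lt ?_ h)
    gcongr
    rw [dist_comm, dist_eq_norm]
    exact PiLp.norm_apply_le (y - x) i
  choose ω hω using h1
  exact ⟨ω, funext hω⟩

theorem exists_rpow_dist_le {n : ℕ} {γ : ℝ} (hγ : γ < 0) {x y : Eucl n} (hxy : x ≠ y) :
    ∃ (k : ℤ) (ω : Fin n → Fin 2), y ∈ (shiftedGrid ω).cell k x ∧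
      ENNReal.ofReal (dist x y ^ γ) ≤ ENNReal.ofReal (6 ^ (-γ)) * 2 ^ (-((k : ℝ) * γ)) := by
  have hd : 0 < dist x y := dist_pos.2 hxy
  obtain ⟨m, hm₁, hm₂⟩ := exists_mem_Ico_zpow (x := 3 * dist x y) (y := (2 : ℝ)) (by positivity)
    (by norm_num)
  rw [← Real.rpow_intCast] at hm₁ hm₂
  have hk : (2 : ℝ) ^ ((-(m + 1) : ℤ) : ℝ) * 2 ^ ((m + 1 : ℤ) : ℝ) = 1 := by
    rw [← Real.rpow_add (by norm_num)]
    push_cast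
    simp
  have h2 : (2 : ℝ) ^ ((m + 1 : ℤ) : ℝ) = 2 * 2 ^ (m : ℝ) := by
    push_cast
    rw [Real.rpow_add (by norm_num), Real.rpow_one, mul_comm]
  have hpos : (0 : ℝ) < 2 ^ ((-(m + 1) : ℤ) : ℝ) := by positivity
  obtain ⟨ω, hω⟩ := exists_shiftedGrid_idx_eq (k := -(m + 1)) (x := x) (y := y) (by nlinarith)
  refine ⟨-(m + 1), ω, hω, ?_⟩
  have h2e : (2 : ℝ≥0∞) ^ (-(((-(m + 1) : ℤ) : ℝ) * γ)) =
      ENNReal.ofReal (2 ^ (-(((-(m + 1) : ℤ) : ℝ) * γ))) := by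
    rw [← ENNReal.ofReal_rpow_of_pos (by norm_num), ENNReal.ofReal_ofNat]
  rw [h2e, ← ENNReal.ofReal_mul (by positivity)]
  refine ENNReal.ofReal_le_ofReal ?_
  have hlow : (2 : ℝ) ^ ((m + 1 : ℤ) : ℝ) / 6 ≤ dist x y := by rw [h2]; linarith
  calc dist x y ^ γ ≤ ((2 : ℝ) ^ ((m + 1 : ℤ) : ℝ) / 6) ^ γ :=
        Real.rpow_le_rpow_of_nonpos (by positivity) hlow hγ.le
    _ = 6 ^ (-γ) * 2 ^ (-(((-(m + 1) : ℤ) : ℝ) * γ)) := by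
        rw [Real.div_rpow (by positivity) (by norm_num), ← Real.rpow_mul (by norm_num),
          Real.rpow_neg (by norm_num), div_eq_inv_mul]
        push_cast
        ring_nf

namespace DyadicGrid

variable {n : ℕ} (G : DyadicGrid n)

theorem prod_edist_le {l : ℕ} (hl : 0 < l) (b : Fin l → Eucl n → ℝ) {k : ℤ} {x y : Eucl n}
    (hy : y ∈ G.cell k x) : ∏ j, edist (b j x) (b j y) ≤
      2 ^ l * ∑ j, G.deviation (b j) l k x * G.deviation (b j) l k y := by
  have : Nonempty (Fin l) := ⟨⟨0, hl⟩⟩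
  obtain ⟨i, -, hi⟩ := Finset.exists_max_image Finset.univ (fun j => edist (b j x) (b j y))
    Finset.univ_nonempty
  have hm : G.mean (b i) k y = G.mean (b i) k x := G.cellConst_mean (b i) k y x hy
  set u := edist (b i x) (G.mean (b i) k x) with hu
  set v := edist (b i y) (G.mean (b i) k y) with hv
  have htri : edist (b i x) (b i y) ≤ 2 * max u v := by
    calc edist (b i x) (b i y) ≤ u + v := by
          rw [hu, hv, hm]; exact edist_triangle_right _ _ _
      _ ≤ max u v + max u v := add_le_add (le_max_left _ _) (le_max_right _ _)
      _ = _ := (two_mul _).symm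
  have hmax : max u v ^ l ≤ G.deviation (b i) l k x * G.deviation (b i) l k y := by
    rcases le_total u v with h | h
    · rw [max_eq_right h]
      calc v ^ l = 1 * v ^ l := (one_mul _).symm
        _ ≤ _ := mul_le_mul' le_self_add le_add_self
    · rw [max_eq_left h]
      calc u ^ l = u ^ l * 1 := (mul_one _).symm
        _ ≤ _ := mul_le_mul' le_add_self le_self_add
  calc ∏ j, edist (b j x) (b j y) ≤ ∏ _j : Fin l, edist (b i x) (b i y) :=
        Finset.prod_le_prod' fun j hj => hi j hj
    _ = edist (b i x) (b i y) ^ l := by simp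
    _ ≤ (2 * max u v) ^ l := by gcongr
    _ = 2 ^ l * max u v ^ l := mul_pow _ _ _
    _ ≤ 2 ^ l * (G.deviation (b i) l k x * G.deviation (b i) l k y) := by gcongr
    _ ≤ _ := by
      gcongr
      exact Finset.single_le_sum (f := fun j => G.deviation (b j) l k x * G.deviation (b j) l k y)
        (fun _ _ => zero_le) (Finset.mem_univ i)

theorem mul_setLIntegral_mul_le_fracTerm (α : ℝ) {u v : ℝ} (huv : v.HolderConjugate u)
    {φ : ℤ → Eucl n → ℝ≥0∞} (hφ : ∀ k, Measurable (φ k)) {f : Eucl n → ℝ≥0∞} (hf : Measurable f)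
    {k : ℤ} {x : Eucl n} {K : ℝ≥0∞} (hK : G.avg k (fun y => φ k y ^ v) x ≤ K) :
    2 ^ (-((k : ℝ) * (α - n))) * (φ k x * ∫⁻ y in G.cell k x, φ k y * f y) ≤
      K ^ (1 / v) * G.fracTerm α u φ f k x := by
  have h2 : (2 : ℝ≥0∞) ^ (-((k : ℝ) * α)) =
      2 ^ (-((k : ℝ) * (α - n))) * 2 ^ (-((k : ℝ) * n)) := by
    rw [← two_rpow_add]; ring_nf
  rw [G.setLIntegral_cell, fracTerm, h2]
  calc _ = 2 ^ (-((k : ℝ) * (α - n))) * 2 ^ (-((k : ℝ) * n)) *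
        (G.avg k (fun y => φ k y * f y) x * φ k x) := by ring
    _ ≤ 2 ^ (-((k : ℝ) * (α - n))) * 2 ^ (-((k : ℝ) * n)) *
        ((K ^ (1 / v) * G.avg k (fun y => f y ^ u) x ^ (1 / u)) * φ k x) := by
      have hv : 0 < v := huv.pos
      refine mul_le_mul_right (mul_le_mul_left ((G.avg_mul_le k huv (hφ k) hf x).trans
        (mul_le_mul_left (ENNReal.rpow_le_rpow hK (by positivity)) _)) _) _
    _ = _ := by ring

end DyadicGrid

theorem tsum_int_eq_add (k₀ : ℤ) (h : ℤ → ℝ≥0∞) :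
    ∑' k, h k = ∑' i : ℕ, h (k₀ + i) + ∑' i : ℕ, h (k₀ - 1 - i) := by
  rw [← (Equiv.addLeft k₀).tsum_eq h, tsum_of_nat_of_neg_add_one ENNReal.summable ENNReal.summable]
  congr 1
  refine tsum_congr fun i => congrArg h ?_
  simp only [Equiv.coe_addLeft]
  ring

theorem enorm_mlCommutator_le {n l : ℕ} (hl : 0 < l) {α : ℝ} (hαn : α < n) {u v : ℝ}
    (huv : v.HolderConjugate u) {b : Fin l → Eucl n → ℝ} (hb : ∀ j, LocallyIntegrable (b j))
    (hb1 : ∀ j, bmoNorm n (b j) ≤ 1) (hbm : ∀ j, Measurable (b j)) {f : Eucl n → ℝ}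
    (hf : Measurable f) (x : Eucl n) :
    ‖mlCommutator n l α b f x‖ₑ ≤ ENNReal.ofReal (6 ^ (-(α - n))) * 2 ^ l *
      DyadicGrid.deviationBound n l v ^ (1 / v) * ∑ ω : Fin n → Fin 2, ∑ j, ∑' k : ℤ,
        (shiftedGrid ω).fracTerm α u ((shiftedGrid ω).deviation (b j) l) (fun y => ‖f y‖ₑ) k x := by
  have hγ : α - n < 0 := by linarith
  set c := ENNReal.ofReal (6 ^ (-(α - n)))
  set φ : (Fin n → Fin 2) → Fin l → ℤ → Eucl n → ℝ≥0∞ :=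
    fun ω j => (shiftedGrid ω).deviation (b j) l with hφ
  have hφm : ∀ ω j k, Measurable (φ ω j k) := fun ω j k =>
    (shiftedGrid ω).measurable_deviation (hbm j) l k
  have hfm : Measurable fun y => ‖f y‖ₑ := hf.enorm
  set g : (Fin n → Fin 2) → Fin l → ℤ → Eucl n → ℝ≥0∞ := fun ω j k y =>
    2 ^ (-((k : ℝ) * (α - n))) * (φ ω j k x *
      ((shiftedGrid ω).cell k x).indicator (fun y => φ ω j k y * ‖f y‖ₑ) y) with hg
  have hgm : ∀ ω j k, Measurable (g ω j k) := fun ω j k =>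
    ((((hφm ω j k).mul hfm).indicator ((shiftedGrid ω).measurableSet_cell k x)).const_mul
      _).const_mul _
  have hpt : ∀ y, ‖(∏ j, (b j x - b j y)) * f y * dist x y ^ (α - (n : ℝ))‖ₑ ≤
      c * 2 ^ l * ∑ ω, ∑ j, ∑' k, g ω j k y := fun y => by
    rcases eq_or_ne x y with rfl | hxy
    · rw [dist_self, Real.zero_rpow hγ.ne]
      simp
    obtain ⟨k, ω, hy, hk⟩ := exists_rpow_dist_le hγ hxy
    have hprod : ‖∏ j, (b j x - b j y)‖ₑ ≤ 2 ^ l * ∑ j, φ ω j k x * φ ω j k y := by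
      refine le_trans (le_of_eq ?_) ((shiftedGrid ω).prod_edist_le hl b hy)
      rw [Real.enorm_eq_ofReal_abs, Finset.abs_prod,
        ENNReal.ofReal_prod_of_nonneg fun _ _ => abs_nonneg _]
      simp_rw [edist_dist, Real.dist_eq]
    rw [enorm_mul, enorm_mul, Real.enorm_of_nonneg (Real.rpow_nonneg dist_nonneg _)]
    calc _ ≤ (2 ^ l * ∑ j, φ ω j k x * φ ω j k y) * ‖f y‖ₑ *
          (c * 2 ^ (-((k : ℝ) * (α - n)))) := mul_le_mul' (mul_le_mul_left hprod _) hk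
      _ = c * 2 ^ l * ∑ j, g ω j k y := by
          simp only [hg, Set.indicator_of_mem hy, Finset.sum_mul, Finset.mul_sum]
          refine Finset.sum_congr rfl fun j _ => ?_
          ring
      _ ≤ c * 2 ^ l * ∑ j, ∑' k, g ω j k y :=
          mul_le_mul_right (Finset.sum_le_sum fun j _ => ENNReal.le_tsum k) _
      _ ≤ _ := mul_le_mul_right (Finset.single_le_sum
          (f := fun ω => ∑ j, ∑' k, g ω j k y) (fun _ _ => zero_le) (Finset.mem_univ ω)) _
  calc ‖mlCommutator n l α b f x‖ₑ ≤ _ := enorm_integral_le_lintegral_enorm _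
    _ ≤ ∫⁻ y, c * 2 ^ l * ∑ ω, ∑ j, ∑' k, g ω j k y := lintegral_mono hpt
    _ = c * 2 ^ l * ∑ ω, ∑ j, ∑' k, ∫⁻ y, g ω j k y := by
        have hm : ∀ ω j, Measurable fun y => ∑' k, g ω j k y := fun ω j =>
          Measurable.tsum fun k => hgm ω j k
        rw [lintegral_const_mul' _ _ (ENNReal.mul_ne_top ENNReal.ofReal_ne_top (by simp)),
          lintegral_finsetSum _ fun ω _ => Finset.measurable_sum _ fun j _ => hm ω j]
        simp_rw [lintegral_finsetSum _ fun j _ => hm _ j,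
          lintegral_tsum fun k => (hgm _ _ k).aemeasurable]
        rfl
    _ ≤ c * 2 ^ l * ∑ ω, ∑ j, ∑' k, DyadicGrid.deviationBound n l v ^ (1 / v) *
          (shiftedGrid ω).fracTerm α u (φ ω j) (fun y => ‖f y‖ₑ) k x := by
        refine mul_le_mul_right (Finset.sum_le_sum fun ω _ => Finset.sum_le_sum fun j _ =>
          ENNReal.tsum_le_tsum fun k => ?_) _
        rw [lintegral_const_mul' _ _ (two_rpow_ne_top _), lintegral_const_mul' _ _
          (by simp [hφ, DyadicGrid.deviation, edist_ne_top]),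
          lintegral_indicator ((shiftedGrid ω).measurableSet_cell k x)]
        exact (shiftedGrid ω).mul_setLIntegral_mul_le_fracTerm α huv (hφm ω j) hfm
          ((shiftedGrid ω).avg_deviation_rpow_le (hb j) (hb1 j) (hbm j) hl huv.lt.le k x)
    _ = _ := by
        simp_rw [ENNReal.tsum_mul_left, ← Finset.mul_sum]
        ring

namespace DyadicGrid

variable {n : ℕ} (G : DyadicGrid n)

theorem avg_enorm_rpow_le_of_morreyNorm_le {p q : ℝ} (hq : 0 < q) {f : Eucl n → ℝ}
    (h : morreyNorm n p q f ≤ ballVolume n ((n : ℝ) + 1) ^ (1 / p - 1 / q)) (k : ℤ) (x : Eucl n) :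
    G.avg k (fun y => ‖f y‖ₑ ^ q) x ≤ 2 ^ ((k : ℝ) * (n / p) * q) := by
  have hR : (0 : ℝ) < (n : ℝ) + 1 := by positivity
  have h2 : (0 : ℝ) < 2 ^ (-(k : ℝ)) := by positivity
  set B := ball x (((n : ℝ) + 1) * (2 : ℝ) ^ (-(k : ℝ)))
  set V := ballVolume n ((n : ℝ) + 1)
  have hV0 : V ≠ 0 := ballVolume_ne_zero n hR
  have hVt : V ≠ ⊤ := ballVolume_ne_top n _
  have hvol : volume B = V * 2 ^ (-((k : ℝ) * n)) := volume_ball_mul_two_rpow x hR k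
  have heq : ∀ y, ENNReal.ofReal (|f y| ^ q) = ‖f y‖ₑ ^ q := fun y => by
    rw [← ENNReal.ofReal_rpow_of_nonneg (abs_nonneg _) hq.le, Real.enorm_eq_ofReal_abs]
  have h1 : volume B ^ (1 / p - 1 / q) * (∫⁻ y in B, ‖f y‖ₑ ^ q) ^ (1 / q) ≤
      V ^ (1 / p - 1 / q) := by
    refine le_trans (le_of_eq ?_) ((le_iSup₂_of_le x _ (le_iSup_of_le (mul_pos hR h2) le_rfl)).trans h)
    simp_rw [heq]
    rfl
  have hV1 : V ^ (1 / p - 1 / q) ≠ 0 := by simp [ENNReal.rpow_eq_zero_iff, hV0, hVt]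
  have hV2 : V ^ (1 / p - 1 / q) ≠ ⊤ := by simp [ENNReal.rpow_eq_top_iff, hV0, hVt]
  rw [hvol, ENNReal.mul_rpow_of_ne_top hVt (two_rpow_ne_top _), ← ENNReal.rpow_mul, mul_assoc] at h1
  have h3 : (2 : ℝ≥0∞) ^ (-((k : ℝ) * n) * (1 / p - 1 / q)) *
      (∫⁻ y in B, ‖f y‖ₑ ^ q) ^ (1 / q) ≤ 1 := by
    rw [← ENNReal.mul_le_mul_iff_right hV1 hV2, mul_one]
    exact h1
  have h4 : (2 : ℝ≥0∞) ^ (-((k : ℝ) * n) * (q / p - 1)) * (∫⁻ y in B, ‖f y‖ₑ ^ q) ≤ 1 := by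
    have := ENNReal.rpow_le_rpow h3 hq.le
    rw [ENNReal.mul_rpow_of_nonneg _ _ hq.le, ← ENNReal.rpow_mul, ← ENNReal.rpow_mul,
      one_div_mul_cancel hq.ne', ENNReal.rpow_one, ENNReal.one_rpow] at this
    convert this using 3
    field_simp
  have h5 : (2 : ℝ≥0∞) ^ ((k : ℝ) * n) =
      2 ^ ((k : ℝ) * (n / p) * q) * 2 ^ (-((k : ℝ) * n) * (q / p - 1)) := by
    rw [← two_rpow_add]; ring_nf
  rw [avg, h5, mul_assoc]
  calc _ ≤ (2 : ℝ≥0∞) ^ ((k : ℝ) * (n / p) * q) *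
        (2 ^ (-((k : ℝ) * n) * (q / p - 1)) * (∫⁻ y in B, ‖f y‖ₑ ^ q)) :=
        mul_le_mul_right (mul_le_mul_right (lintegral_mono_set (G.cell_subset_ball k x)) _) _
    _ ≤ _ := mul_le_of_le_one_right' h4

theorem setLIntegral_ball_le_of_avg_le {g : Eucl n → ℝ≥0∞} (hg : Measurable g) {k : ℤ}
    {M : ℝ≥0∞} (h : ∀ x, G.avg k g x ≤ M) (x₀ : Eucl n) :
    ∫⁻ x in ball x₀ (2 * (2 : ℝ) ^ (-(k : ℝ))), g x ≤
      M * (ballVolume n ((n : ℝ) + 3) * 2 ^ (-((k : ℝ) * n))) := by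
  set B := ball x₀ (2 * (2 : ℝ) ^ (-(k : ℝ)))
  set E : Set (Eucl n) := {x | ∃ y ∈ B, G.idx k y = G.idx k x} with hE
  have hEu : G.CellUnion k E := fun x y hxy => by
    simp only [hE, Set.mem_ofPred_eq, hxy]
  have hBE : B ⊆ E := fun x hx => ⟨x, hx, rfl⟩
  have hEB : E ⊆ ball x₀ (((n : ℝ) + 3) * (2 : ℝ) ^ (-(k : ℝ))) := by
    rintro x ⟨y, hy, hyx⟩
    have h1 := mem_ball.1 (G.cell_subset_ball k x (G.mem_cell.2 hyx))
    have h2 := mem_ball.1 hy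
    rw [mem_ball]
    have := dist_triangle_left x x₀ y
    linarith
  calc ∫⁻ x in B, g x ≤ ∫⁻ x in E, g x := lintegral_mono_set hBE
    _ = ∫⁻ x in E, G.avg k g x := (hEu.setLIntegral_avg hg).symm
    _ ≤ ∫⁻ _x in E, M := lintegral_mono h
    _ = M * volume E := by simp
    _ ≤ M * volume (ball x₀ (((n : ℝ) + 3) * (2 : ℝ) ^ (-(k : ℝ)))) := by gcongr
    _ = _ := by rw [volume_ball_mul_two_rpow x₀ (by positivity)]

end DyadicGrid

theorem morreyNorm_le_of_setLIntegral_dyadic_le {n : ℕ} {s t : ℝ} (ht : 0 < t) (hts : t ≤ s)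
    {f : Eucl n → ℝ} {C : ℝ≥0∞} (h : ∀ (k : ℤ) x,
      ∫⁻ y in ball x (2 * (2 : ℝ) ^ (-(k : ℝ))), ‖f y‖ₑ ^ t ≤ C * 2 ^ ((k : ℝ) * (n / s * t - n))) :
    morreyNorm n s t f ≤ ballVolume n 1 ^ (1 / s - 1 / t) * C ^ (1 / t) := by
  refine iSup₂_le fun x r => iSup_le fun hr => ?_
  obtain ⟨m, hm₁, hm₂⟩ := exists_mem_Ico_zpow (x := r) (y := (2 : ℝ)) hr (by norm_num)
  rw [← Real.rpow_intCast] at hm₁ hm₂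
  have hk : ((-m : ℤ) : ℝ) = -m := by simp
  have hm₁' : 1 * (2 : ℝ) ^ (-((-m : ℤ) : ℝ)) ≤ r := by rwa [hk, neg_neg, one_mul]
  have hm₂' : r ≤ 2 * (2 : ℝ) ^ (-((-m : ℤ) : ℝ)) := by
    rw [hk, neg_neg, mul_comm]
    push_cast at hm₂
    rw [Real.rpow_add (by norm_num), Real.rpow_one] at hm₂
    exact hm₂.le
  generalize -m = k at hm₁' hm₂'
  have hs : 0 < s := ht.trans_le hts
  have he : 1 / s - 1 / t ≤ 0 := sub_nonpos.2 (one_div_le_one_div_of_le ht hts)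
  have h1 : volume (ball x r) ^ (1 / s - 1 / t) ≤
      (ballVolume n 1 * 2 ^ (-((k : ℝ) * n))) ^ (1 / s - 1 / t) := by
    rw [← volume_ball_mul_two_rpow x one_pos]
    rw [← neg_neg (1 / s - 1 / t), ENNReal.rpow_neg, ENNReal.rpow_neg _ (-(1 / s - 1 / t)),
      ENNReal.inv_le_inv]
    exact ENNReal.rpow_le_rpow (measure_mono (ball_subset_ball hm₁')) (neg_nonneg.2 he)
  have h2 : ∫⁻ y in ball x r, ENNReal.ofReal (|f y| ^ t) ≤
      C * 2 ^ ((k : ℝ) * (n / s * t - n)) := by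
    refine le_trans (le_of_eq ?_) ((lintegral_mono_set (ball_subset_ball hm₂')).trans (h k x))
    refine lintegral_congr fun y => ?_
    rw [← ENNReal.ofReal_rpow_of_nonneg (abs_nonneg _) ht.le, Real.enorm_eq_ofReal_abs]
  refine (mul_le_mul' h1 (ENNReal.rpow_le_rpow h2 (by positivity))).trans (le_of_eq ?_)
  rw [ENNReal.mul_rpow_of_ne_top (ballVolume_ne_top n 1) (two_rpow_ne_top _),
    ENNReal.mul_rpow_of_nonneg _ _ (by positivity : (0 : ℝ) ≤ 1 / t), ← ENNReal.rpow_mul,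
    ← ENNReal.rpow_mul, mul_mul_mul_comm, ← two_rpow_add]
  have h0 : -((k : ℝ) * n) * (1 / s - 1 / t) + (k : ℝ) * (n / s * t - n) * (1 / t) = 0 := by
    field_simp
    ring
  rw [h0, ENNReal.rpow_zero, mul_one]

theorem DyadicGrid.exists_avg_tsum_int_fracTerm_rpow_le {α σ u q t : ℝ} (hα : 0 < α) (hσ : 0 < σ)
    (hu : 0 < u) (huq : u < q) (ht : 1 < t) (hqt : q * (α + σ) = t * σ) {K : ℝ → ℝ≥0∞}
    (hK : ∀ r, K r ≠ ⊤) (n : ℕ) :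
    ∃ C : ℝ≥0∞, C ≠ ⊤ ∧ ∀ (G : DyadicGrid n) (φ : ℤ → Eucl n → ℝ≥0∞),
      (∀ k, Measurable (φ k)) →
      (∀ r, 1 ≤ r → ∀ k x, G.avg k (fun y => φ k y ^ r) x ≤ K r) →
      ∀ f : Eucl n → ℝ≥0∞, Measurable f →
      (∀ k x, G.avg k (fun y => f y ^ q) x ≤ 2 ^ ((k : ℝ) * (α + σ) * q)) →
      ∀ (k₀ : ℤ) (x₀ : Eucl n),
      G.avg k₀ (fun x => (∑' k : ℤ, G.fracTerm α u φ f k x) ^ t) x₀ ≤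
        C * 2 ^ ((k₀ : ℝ) * σ * t) := by
  obtain ⟨C₁, hC₁, h₁⟩ := exists_avg_tsum_fracTerm_add_rpow_le hα hσ hu huq ht hqt hK
  obtain ⟨C₂, hC₂, h₂⟩ := exists_avg_tsum_fracTerm_sub_rpow_le (α := α) hσ hu huq ht hK n
  refine ⟨2 ^ (t - 1) * (C₁ + C₂), ENNReal.mul_ne_top (two_rpow_ne_top _)
    (ENNReal.add_ne_top.2 ⟨hC₁, hC₂⟩), fun G φ hφ hφK f hf hfq k x => ?_⟩
  have hA := h₁ G φ hφ hφK f hf hfq k x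
  have hB := h₂ G φ hφ hφK f hf hfq k x
  have hAm : Measurable fun x => (∑' i : ℕ, G.fracTerm α u φ f (k + i) x) ^ t :=
    (Measurable.tsum fun i => G.measurable_fracTerm α u hφ f _).pow_const t
  calc G.avg k (fun x => (∑' k : ℤ, G.fracTerm α u φ f k x) ^ t) x
      ≤ G.avg k (fun x => 2 ^ (t - 1) * ((∑' i : ℕ, G.fracTerm α u φ f (k + i) x) ^ t +
          (∑' i : ℕ, G.fracTerm α u φ f (k - 1 - i) x) ^ t)) x := G.avg_mono k x fun y _ => by
        rw [tsum_int_eq_add k]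
        exact ENNReal.rpow_add_le_mul_rpow_add_rpow _ _ ht.le
    _ ≤ 2 ^ (t - 1) * (C₁ * 2 ^ ((k : ℝ) * σ * t) + C₂ * 2 ^ ((k : ℝ) * σ * t)) := by
        rw [G.avg_const_mul k (two_rpow_ne_top _), G.avg_add k hAm]
        exact mul_le_mul_right (add_le_add hA hB) _
    _ = _ := by ring

theorem exists_morreyNorm_mlCommutator_le {n l : ℕ} (hl : 0 < l) {α p q s t : ℝ}
    (hα : 0 < α) (hαn : α < n) (hq : 1 < q) (hqp : q ≤ p)
    (hs : 1 / s = 1 / p - α / n) (hs0 : 0 < 1 / s) (hst : p / q = s / t) :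
    ∃ C : ℝ≥0∞, C ≠ ⊤ ∧ ∀ b : Fin l → Eucl n → ℝ, (∀ j, LocallyIntegrable (b j)) →
      (∀ j, bmoNorm n (b j) ≤ 1) → (∀ j, Measurable (b j)) → ∀ f : Eucl n → ℝ, Measurable f →
      morreyNorm n p q f ≤ ballVolume n ((n : ℝ) + 1) ^ (1 / p - 1 / q) →
      morreyNorm n s t (mlCommutator n l α b f) ≤ C := by
  have hn : (0 : ℝ) < n := hα.trans hαn
  have hq0 : 0 < q := by linarith
  have hp : 0 < p := by linarith
  have hs' : 0 < s := one_div_pos.1 hs0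
  have ht0 : t ≠ 0 := by
    rintro rfl
    rw [_root_.div_zero] at hst
    exact (div_pos hp hq0).ne' hst
  have htq : t * p = s * q := by
    field_simp at hst
    linarith
  have hαp : s * (n - α * p) = n * p := by
    field_simp at hs
    linarith
  have hps : p < s := by nlinarith [mul_pos hs' (mul_pos hα hp)]
  have hqt : q < t := by nlinarith
  have ht : 1 < t := hq.trans hqt
  have hts : t ≤ s := by nlinarith
  have hσ : 0 < (n : ℝ) / s := by positivity
  have hασ : α + n / s = n / p := by
    field_simp
    linarith
  have hqσ : q * (α + n / s) = t * (n / s) := by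
    rw [hασ]
    field_simp
    linarith
  set u : ℝ := (1 + q) / 2 with hu
  have hu1 : 1 < u := by rw [hu]; linarith
  have huq : u < q := by rw [hu]; linarith
  have hu0 : 0 < u := by linarith
  have huv := (Real.HolderConjugate.conjExponent hu1).symm
  set v := u.conjExponent
  obtain ⟨C₃, hC₃t, h₃⟩ := DyadicGrid.exists_avg_tsum_int_fracTerm_rpow_le hα hσ hu0 huq ht hqσ
    (DyadicGrid.deviationBound_ne_top n l) n
  set D := ENNReal.ofReal (6 ^ (-(α - n))) * 2 ^ l * DyadicGrid.deviationBound n l v ^ (1 / v)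
  have hD : D ≠ ⊤ := ENNReal.mul_ne_top (ENNReal.mul_ne_top ENNReal.ofReal_ne_top (by simp))
    (ENNReal.rpow_ne_top_of_nonneg (one_div_nonneg.2 huv.nonneg)
      (DyadicGrid.deviationBound_ne_top n l v))
  set ι := (Fin n → Fin 2) × Fin l
  set M : ℝ≥0∞ := (Fintype.card ι : ℝ≥0∞)
  set V := ballVolume n ((n : ℝ) + 3)
  set C₄ := D ^ t * (M ^ (t - 1) * (M * (C₃ * V))) with hC₄
  have hM : M ≠ ⊤ := ENNReal.natCast_ne_top _
  have hC₄t : C₄ ≠ ⊤ := ENNReal.mul_ne_top (ENNReal.rpow_ne_top_of_nonneg (by linarith) hD)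
    (ENNReal.mul_ne_top (ENNReal.rpow_ne_top_of_nonneg (by linarith) hM)
      (ENNReal.mul_ne_top hM (ENNReal.mul_ne_top hC₃t (ballVolume_ne_top _ _))))
  refine ⟨ballVolume n 1 ^ (1 / s - 1 / t) * C₄ ^ (1 / t), ENNReal.mul_ne_top ?_
    (ENNReal.rpow_ne_top_of_nonneg (by positivity) hC₄t), fun b hb hb1 hbm f hf hfM => ?_⟩
  · simp [ENNReal.rpow_eq_top_iff, ballVolume_ne_zero n one_pos, ballVolume_ne_top]
  set φ : (Fin n → Fin 2) → Fin l → ℤ → Eucl n → ℝ≥0∞ :=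
    fun ω j => (shiftedGrid ω).deviation (b j) l with hφ
  have hφm : ∀ ω j k, Measurable (φ ω j k) := fun ω j k =>
    (shiftedGrid ω).measurable_deviation (hbm j) l k
  set T : ι → Eucl n → ℝ≥0∞ := fun i x => ∑' k : ℤ,
    (shiftedGrid i.1).fracTerm α u (φ i.1 i.2) (fun y => ‖f y‖ₑ) k x with hT
  have hTm : ∀ i, Measurable (T i) := fun i =>
    Measurable.tsum fun k => (shiftedGrid i.1).measurable_fracTerm α u (hφm i.1 i.2) _ k
  have hTavg : ∀ i (k : ℤ) x, (shiftedGrid i.1).avg k (fun y => T i y ^ t) x ≤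
      C₃ * 2 ^ ((k : ℝ) * (n / s) * t) := fun ⟨ω, j⟩ k x => by
    have hfq : ∀ (k : ℤ) x, (shiftedGrid ω).avg k (fun y => ‖f y‖ₑ ^ q) x ≤
        2 ^ ((k : ℝ) * (α + n / s) * q) := fun k x => by
      rw [hασ]
      exact (shiftedGrid ω).avg_enorm_rpow_le_of_morreyNorm_le hq0 hfM k x
    have hφr : ∀ r, 1 ≤ r → ∀ (k : ℤ) x, (shiftedGrid ω).avg k (fun y => φ ω j k y ^ r) x ≤
        DyadicGrid.deviationBound n l r := fun r hr k x =>
      (shiftedGrid ω).avg_deviation_rpow_le (hb j) (hb1 j) (hbm j) hl hr k x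
    exact h₃ (shiftedGrid ω) (φ ω j) (hφm ω j) hφr _ hf.enorm hfq k x
  refine morreyNorm_le_of_setLIntegral_dyadic_le (by linarith) hts fun k x => ?_
  have h2 : (2 : ℝ≥0∞) ^ ((k : ℝ) * (n / s * t - n)) =
      2 ^ ((k : ℝ) * (n / s) * t) * 2 ^ (-((k : ℝ) * n)) := by
    rw [← two_rpow_add]; ring_nf
  have hpt : ∀ y, ‖mlCommutator n l α b f y‖ₑ ^ t ≤ D ^ t * (M ^ (t - 1) * ∑ i, T i y ^ t) :=
    fun y => by
    have h := enorm_mlCommutator_le hl hαn huv hb hb1 hbm hf y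
    rw [← Fintype.sum_prod_type' (f := fun ω j => T (ω, j) y)] at h
    refine (ENNReal.rpow_le_rpow h (by linarith)).trans ?_
    rw [ENNReal.mul_rpow_of_nonneg _ _ (by linarith)]
    refine mul_le_mul_right ?_ _
    exact ENNReal.rpow_sum_le_const_mul_sum_rpow Finset.univ _ ht.le
  have hfin : M ^ (t - 1) * ∑ _i : ι, C₃ * 2 ^ ((k : ℝ) * (n / s) * t) *
      (V * 2 ^ (-((k : ℝ) * n))) = M ^ (t - 1) * (M * (C₃ * V)) *
        2 ^ ((k : ℝ) * (n / s * t - n)) := by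
    rw [h2, Finset.sum_const, Finset.card_univ, nsmul_eq_mul]
    change M ^ (t - 1) * (M * _) = _
    clear_value M V
    ring
  have hint : ∀ i, ∫⁻ y in ball x (2 * (2 : ℝ) ^ (-(k : ℝ))), T i y ^ t ≤
      C₃ * 2 ^ ((k : ℝ) * (n / s) * t) * (V * 2 ^ (-((k : ℝ) * n))) := fun i =>
    (shiftedGrid i.1).setLIntegral_ball_le_of_avg_le ((hTm i).pow_const t) (hTavg i k) x
  clear_value T D M V
  calc ∫⁻ y in ball x (2 * (2 : ℝ) ^ (-(k : ℝ))), ‖mlCommutator n l α b f y‖ₑ ^ t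
      ≤ ∫⁻ y in ball x (2 * (2 : ℝ) ^ (-(k : ℝ))), D ^ t * (M ^ (t - 1) * ∑ i, T i y ^ t) :=
        lintegral_mono hpt
    _ = D ^ t * (M ^ (t - 1) * ∑ i, ∫⁻ y in ball x (2 * (2 : ℝ) ^ (-(k : ℝ))), T i y ^ t) := by
        rw [lintegral_const_mul' _ _ (ENNReal.rpow_ne_top_of_nonneg (by linarith) hD),
          lintegral_const_mul' _ _ (ENNReal.rpow_ne_top_of_nonneg (by linarith) hM),
          lintegral_finsetSum _ fun i _ => (hTm i).pow_const t]
    _ ≤ D ^ t * (M ^ (t - 1) * ∑ _i : ι, C₃ * 2 ^ ((k : ℝ) * (n / s) * t) *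
          (V * 2 ^ (-((k : ℝ) * n)))) :=
        mul_le_mul_right (mul_le_mul_right (Finset.sum_le_sum fun i _ => hint i) _) _
    _ = C₄ * 2 ^ ((k : ℝ) * (n / s * t - n)) := by
        rw [hfin, hC₄, ← mul_assoc (D ^ t)]

theorem morreyNorm_const_mul_le {n : ℕ} {p q : ℝ} (hq : 0 < q) (c : ℝ) (f : Eucl n → ℝ) :
    morreyNorm n p q (fun x => c * f x) ≤ ‖c‖ₑ * morreyNorm n p q f := by
  refine iSup₂_le fun x r => iSup_le fun hr => ?_
  have h : ∀ y, ENNReal.ofReal (|c * f y| ^ q) = ‖c‖ₑ ^ q * ENNReal.ofReal (|f y| ^ q) := fun y => by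
    rw [abs_mul, Real.mul_rpow (abs_nonneg _) (abs_nonneg _), ENNReal.ofReal_mul (by positivity),
      ← ENNReal.ofReal_rpow_of_nonneg (abs_nonneg c) hq.le, Real.enorm_eq_ofReal_abs]
  simp_rw [h]
  rw [lintegral_const_mul' _ _ (ENNReal.rpow_ne_top_of_nonneg hq.le enorm_ne_top),
    ENNReal.mul_rpow_of_nonneg _ _ (by positivity), ← ENNReal.rpow_mul, mul_one_div_cancel hq.ne',
    ENNReal.rpow_one, mul_left_comm]
  refine mul_le_mul_right ?_ _
  exact le_iSup₂_of_le (f := fun x r => ⨆ _ : 0 < r, volume (ball x r) ^ (1 / p - 1 / q) *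
    (∫⁻ y in ball x r, ENNReal.ofReal (|f y| ^ q)) ^ (1 / q)) x r (le_iSup_of_le hr le_rfl)

theorem morreyNorm_congr_ae {n : ℕ} {p q : ℝ} {f g : Eucl n → ℝ} (h : f =ᵐ[volume] g) :
    morreyNorm n p q f = morreyNorm n p q g := by
  simp only [morreyNorm]
  congr! 7 with x r hr
  refine lintegral_congr_ae (ae_restrict_of_ae ?_)
  filter_upwards [h] with y hy
  rw [hy]

theorem bmoNorm_const_mul_le {n : ℕ} (c : ℝ) (b : Eucl n → ℝ) :
    bmoNorm n (fun x => c * b x) ≤ ‖c‖ₑ * bmoNorm n b := by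
  refine iSup₂_le fun x r => iSup_le fun hr => ?_
  have h : ∀ y, ENNReal.ofReal |c * b y - ballAvg n (fun x => c * b x) x r| =
      ‖c‖ₑ * ENNReal.ofReal |b y - ballAvg n b x r| := fun y => by
    rw [ballAvg, setAverage_eq, integral_const_mul, smul_eq_mul, mul_left_comm, ← mul_sub, abs_mul,
      ENNReal.ofReal_mul (abs_nonneg _), Real.enorm_eq_ofReal_abs, ballAvg, setAverage_eq,
      smul_eq_mul]
  simp_rw [h]
  rw [lintegral_const_mul' _ _ enorm_ne_top, mul_left_comm]
  refine mul_le_mul_right ?_ _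
  exact le_iSup₂_of_le (f := fun x r => ⨆ _ : 0 < r, (volume (ball x r))⁻¹ *
    ∫⁻ y in ball x r, ENNReal.ofReal |b y - ballAvg n b x r|) x r (le_iSup_of_le hr le_rfl)

theorem bmoNorm_congr_ae {n : ℕ} {a b : Eucl n → ℝ} (h : a =ᵐ[volume] b) :
    bmoNorm n a = bmoNorm n b := by
  have havg : ∀ x r, ballAvg n a x r = ballAvg n b x r := fun x r => by
    rw [ballAvg, ballAvg, setAverage_eq, setAverage_eq,
      setIntegral_congr_ae measurableSet_ball (h.mono fun y hy _ => hy)]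
  simp only [bmoNorm]
  congr! 6 with x r hr
  refine lintegral_congr_ae (ae_restrict_of_ae ?_)
  filter_upwards [h] with y hy
  rw [hy, havg]

theorem mlCommutator_congr_ae {n l : ℕ} {α : ℝ} {a b : Fin l → Eucl n → ℝ}
    (h : ∀ j, a j =ᵐ[volume] b j) (f : Eucl n → ℝ) :
    mlCommutator n l α a f =ᵐ[volume] mlCommutator n l α b f := by
  have h' := ae_all_iff.2 h
  filter_upwards [h'] with x hx
  refine integral_congr_ae ?_
  filter_upwards [h'] with y hy
  simp only [hx, hy]

theorem mlCommutator_const_mul {n l : ℕ} {α : ℝ} (c : Fin l → ℝ) (d : ℝ)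
    (a : Fin l → Eucl n → ℝ) (f : Eucl n → ℝ) (x : Eucl n) :
    mlCommutator n l α (fun j x => c j * a j x) (fun x => d * f x) x =
      (∏ j, c j) * d * mlCommutator n l α a f x := by
  rw [mlCommutator, mlCommutator, ← integral_const_mul]
  congr 1
  funext y
  simp_rw [← mul_sub, Finset.prod_mul_distrib]
  ring

/-- A scaling argument: a bound on the unit balls gives a multilinear bound. -/
theorem morreyNorm_mlCommutator_le_of_forall_le {n l : ℕ} {α p q s t : ℝ} (hq : 0 < q) (ht : 0 < t)
    {κ : ℝ} (hκ : 0 < κ) {C : ℝ} (hC : 0 ≤ C)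
    (H : ∀ b : Fin l → Eucl n → ℝ, (∀ j, LocallyIntegrable (b j)) →
      (∀ j, bmoNorm n (b j) ≤ 1) → (∀ j, Measurable (b j)) → ∀ f : Eucl n → ℝ, Measurable f →
      morreyNorm n p q f ≤ ENNReal.ofReal κ →
      morreyNorm n s t (mlCommutator n l α b f) ≤ ENNReal.ofReal C)
    {a : Fin l → Eucl n → ℝ} (ha : ∀ j, MemBMO n (a j)) (ham : ∀ j, Measurable (a j))
    {f : Eucl n → ℝ} (hf : MemMorrey n p q f) :
    morreyNorm n s t (mlCommutator n l α a f) ≤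
      ENNReal.ofReal (C / κ) * (∏ j, bmoNorm n (a j)) * morreyNorm n p q f := by
  obtain ⟨A, hA0, hAe⟩ : ∃ A : Fin l → ℝ, (∀ j, 0 ≤ A j) ∧
      ∀ j, bmoNorm n (a j) = ENNReal.ofReal (A j) :=
    ⟨fun j => (bmoNorm n (a j)).toReal, fun _ => ENNReal.toReal_nonneg,
      fun j => (ENNReal.ofReal_toReal (ha j).2.ne).symm⟩
  obtain ⟨N, hN0, hNe⟩ : ∃ N : ℝ, 0 ≤ N ∧ morreyNorm n p q f = ENNReal.ofReal N :=
    ⟨_, ENNReal.toReal_nonneg, (ENNReal.ofReal_toReal hf.2.ne).symm⟩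
  have key : ∀ ε : ℝ, 0 < ε → morreyNorm n s t (mlCommutator n l α a f) ≤
      ENNReal.ofReal (C / κ * (∏ j, (A j + ε)) * (N + ε)) := fun ε hε => by
    have hAε : ∀ j, 0 < A j + ε := fun j => by linarith [hA0 j]
    have hNε : 0 < N + ε := by linarith
    set b : Fin l → Eucl n → ℝ := fun j x => (A j + ε)⁻¹ * a j x with hb
    set g : Eucl n → ℝ := fun x => (κ / (N + ε)) * f x with hg
    have hcomm : mlCommutator n l α a f = fun x =>
        ((∏ j, (A j + ε)) * ((N + ε) / κ)) * mlCommutator n l α b g x := by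
      funext x
      rw [← mlCommutator_const_mul]
      congr 1
      · funext j y
        rw [hb]
        field_simp [(hAε j).ne']
      · funext y
        rw [hg]
        field_simp
    have hb1 : ∀ j, bmoNorm n (b j) ≤ 1 := fun j => by
      refine (bmoNorm_const_mul_le _ _).trans ?_
      rw [hAe, Real.enorm_of_nonneg (inv_nonneg.2 (hAε j).le),
        ← ENNReal.ofReal_mul (inv_nonneg.2 (hAε j).le), ENNReal.ofReal_le_one, inv_mul_le_one₀ (hAε j)]
      linarith
    have hg1 : morreyNorm n p q g ≤ ENNReal.ofReal κ := by
      refine (morreyNorm_const_mul_le hq _ _).trans ?_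
      rw [hNe, Real.enorm_of_nonneg (by positivity), ← ENNReal.ofReal_mul (by positivity)]
      refine ENNReal.ofReal_le_ofReal ?_
      rw [div_mul_eq_mul_div, div_le_iff₀ hNε]
      nlinarith
    have hprod : 0 ≤ ∏ j, (A j + ε) := Finset.prod_nonneg fun j _ => (hAε j).le
    rw [hcomm]
    have hbi : ∀ j, LocallyIntegrable (b j) := fun j => (ha j).1.smul (A j + ε)⁻¹
    have hbm : ∀ j, Measurable (b j) := fun j => (ham j).const_mul _
    have hgm : Measurable g := hf.1.const_mul _
    refine (morreyNorm_const_mul_le ht _ _).trans ((mul_le_mul_right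
      (H b hbi hb1 hbm g hgm hg1) _).trans (le_of_eq ?_))
    have hc : 0 ≤ (∏ j, (A j + ε)) * ((N + ε) / κ) := mul_nonneg hprod (div_pos hNε hκ).le
    rw [Real.enorm_of_nonneg hc, ← ENNReal.ofReal_mul hc]
    congr 1
    ring
  have hlim : Filter.Tendsto (fun ε : ℝ => ENNReal.ofReal (C / κ * (∏ j, (A j + ε)) * (N + ε)))
      (nhdsWithin 0 (Set.Ioi 0)) (nhds (ENNReal.ofReal (C / κ * (∏ j, (A j + 0)) * (N + 0)))) := by
    refine Filter.Tendsto.mono_left (Continuous.tendsto ?_ 0) nhdsWithin_le_nhds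
    exact ENNReal.continuous_ofReal.comp (by fun_prop)
  refine (ge_of_tendsto hlim (Filter.eventually_of_mem self_mem_nhdsWithin key)).trans
    (le_of_eq ?_)
  have hprod : 0 ≤ ∏ j, A j := Finset.prod_nonneg fun j _ => hA0 j
  simp_rw [add_zero, hAe, hNe]
  rw [ENNReal.ofReal_mul (by positivity), ENNReal.ofReal_mul (by positivity),
    ENNReal.ofReal_prod_of_nonneg fun j _ => hA0 j]

/-- boundedness of the multilinear commutator with operator norm
controlled by the product of the BMO norms of the symbols. -/
theorem mlCommutator_morreyNorm_le_prod_bmoNorm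
    (n l : ℕ) (hn : 1 ≤ n) (hl : 0 < l) (α p q s t : ℝ)
    (hα : 0 < α) (hαn : α < n) (hq : 1 < q) (hqp : q ≤ p)
    (hs : 1 / s = 1 / p - α / n) (hs0 : 0 < 1 / s) (hst : p / q = s / t) :
    ∃ C : ℝ, 0 < C ∧ ∀ a : Fin l → Eucl n → ℝ, (∀ j, MemBMO n (a j)) →
      ∀ f : Eucl n → ℝ, MemMorrey n p q f →
        morreyNorm n s t (mlCommutator n l α a f) ≤
          ENNReal.ofReal C * (∏ j, bmoNorm n (a j)) * morreyNorm n p q f := by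
  have hs' : 0 < s := one_div_pos.1 hs0
  have ht : 0 < t := by
    have : 0 < s / t := hst ▸ div_pos (by linarith) (by linarith)
    exact (div_pos_iff_of_pos_left hs').1 this
  obtain ⟨C, hC, H⟩ := exists_morreyNorm_mlCommutator_le hl hα hαn hq hqp hs hs0 hst
  set K := ballVolume n ((n : ℝ) + 1) ^ (1 / p - 1 / q)
  have hV0 := ballVolume_ne_zero n (by positivity : (0 : ℝ) < (n : ℝ) + 1)
  have hVt := ballVolume_ne_top n ((n : ℝ) + 1)
  have hK0 : K ≠ 0 := by simp [K, ENNReal.rpow_eq_zero_iff, hV0, hVt]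
  have hKt : K ≠ ⊤ := by simp [K, ENNReal.rpow_eq_top_iff, hV0, hVt]
  have hκ : 0 < K.toReal := ENNReal.toReal_pos hK0 hKt
  refine ⟨(C.toReal + 1) / K.toReal, by positivity, fun a ha f hf => ?_⟩
  choose b hbm hab using fun j => (ha j).1.aestronglyMeasurable.aemeasurable
  have hb : ∀ j, MemBMO n (b j) := fun j =>
    ⟨(ha j).1.congr (hab j), (bmoNorm_congr_ae (hab j)) ▸ (ha j).2⟩
  rw [morreyNorm_congr_ae (mlCommutator_congr_ae hab f),
    Finset.prod_congr rfl fun j _ => bmoNorm_congr_ae (hab j)]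
  refine morreyNorm_mlCommutator_le_of_forall_le (by linarith) ht hκ (by positivity)
    (fun b hb hb1 hbm f hf hfK => ?_) hb hbm hf
  rw [ENNReal.ofReal_toReal hKt] at hfK
  refine (H b hb hb1 hbm f hf hfK).trans ?_
  rw [← ENNReal.ofReal_toReal hC]
  exact ENNReal.ofReal_le_ofReal (by simp)
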